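/- arXiv:1808.09696 — 3 statements merged into one kernel-verified Lean document; each statement's English description precedes it below -/
import Mathlib

section
/- Let A be a complex semisimple unital Banach algebra and let J be an inessential ideal of A (every element of J has spectrum that is either finite or a sequence converging to 0). If s ∈ J and λ is a nonzero isolated point of the spectrum of s, then the Riesz projection p(λ, s) associated to λ is a finite rank element of A, i.e., the set {#σ(p x) : x ∈ A} is bounded, where p = p(λ,s). -/
noncomputable section

/-- `rank a ≤ n`: for every `x`, the nonzero spectrum of `x * a` is finite with at most
`n` elements. -/
def rankLE {A : Type*} [NormedRing A] [NormedAlgebra ℂ A] (a : A) (n : ℕ) : Prop :=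
  ∀ x : A, (spectrum ℂ (x * a) \ {0}).Finite ∧ (spectrum ℂ (x * a) \ {0}).ncard ≤ n


open Metric in
lemma rz_clm {A : Type*} [NormedRing A] [NormedAlgebra ℂ A] [CompleteSpace A]
    (L : A →L[ℂ] A) {f : ℂ → A} {c : ℂ} {R : ℝ} (hf : CircleIntegrable f c R) :
    circleIntegral (fun z => L (f z)) c R = L (circleIntegral f c R) := by
  unfold circleIntegral
  rw [← ContinuousLinearMap.intervalIntegral_comp_comm L hf.out]
  simp

lemma rz_mul_left {A : Type*} [NormedRing A] [NormedAlgebra ℂ A] [CompleteSpace A]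
    (a : A) {f : ℂ → A} {c : ℂ} {R : ℝ} (hf : CircleIntegrable f c R) :
    circleIntegral (fun z => a * f z) c R = a * (circleIntegral f c R) :=
  rz_clm (ContinuousLinearMap.mul ℂ A a) hf

lemma rz_mul_right {A : Type*} [NormedRing A] [NormedAlgebra ℂ A] [CompleteSpace A]
    (a : A) {f : ℂ → A} {c : ℂ} {R : ℝ} (hf : CircleIntegrable f c R) :
    circleIntegral (fun z => f z * a) c R = (circleIntegral f c R) * a :=
  rz_clm ((ContinuousLinearMap.mul ℂ A).flip a) hf

/-- Isolation of `lam` in the closed disc of radius `r`. -/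
def RzIso {A : Type*} [NormedRing A] [NormedAlgebra ℂ A] (s : A) (lam : ℂ) (r : ℝ) : Prop :=
  ∀ μ ∈ spectrum ℂ s, ‖μ - lam‖ ≤ r → μ = lam

lemma rz_res {A : Type*} [NormedRing A] [NormedAlgebra ℂ A]
    {s : A} {lam : ℂ} {r : ℝ} (h : RzIso s lam r) {z : ℂ} (hz : ‖z - lam‖ ≤ r)
    (hne : z ≠ lam) : z ∈ resolventSet ℂ s := by
  by_contra hc
  exact hne (h z hc hz)

lemma rz_res_sphere {A : Type*} [NormedRing A] [NormedAlgebra ℂ A]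
    {s : A} {lam : ℂ} {r : ℝ} (h : RzIso s lam r) (hr : 0 < r) {z : ℂ}
    (hz : z ∈ Metric.sphere lam r) : z ∈ resolventSet ℂ s := by
  rw [mem_sphere_iff_norm] at hz
  refine rz_res h hz.le ?_
  rintro rfl
  simp at hz
  exact hr.ne hz

lemma rz_contAt {A : Type*} [NormedRing A] [NormedAlgebra ℂ A] [CompleteSpace A]
    {s : A} {z : ℂ} (hz : z ∈ resolventSet ℂ s) : DifferentiableAt ℂ (resolvent s) z :=
  (spectrum.hasDerivAt_resolvent_const_left hz).differentiableAt

lemma rz_contOn {A : Type*} [NormedRing A] [NormedAlgebra ℂ A] [CompleteSpace A]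
    {s : A} {lam : ℂ} {r : ℝ} (h : RzIso s lam r) (hr : 0 < r) :
    ContinuousOn (resolvent s : ℂ → A) (Metric.sphere lam r) := fun _ hz =>
  (rz_contAt (rz_res_sphere h hr hz)).continuousAt.continuousWithinAt

lemma rz_radius {A : Type*} [NormedRing A] [NormedAlgebra ℂ A] [CompleteSpace A]
    {s : A} {lam : ℂ} {r r' : ℝ} (h : RzIso s lam r) (hr' : 0 < r') (hle : r' ≤ r) :
    circleIntegral (resolvent s) lam r = circleIntegral (resolvent s) lam r' := by
  have key : ∀ z ∈ Metric.closedBall lam r \ Metric.ball lam r',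
      DifferentiableAt ℂ (resolvent s : ℂ → A) z := by
    rintro z ⟨h1, h2⟩
    refine rz_contAt (rz_res h (by simpa [dist_eq_norm] using h1) ?_)
    rintro rfl
    simp [hr'] at h2
  refine Complex.circleIntegral_eq_of_differentiable_on_annulus_off_countable hr' hle
    Set.countable_empty (fun z hz => (key z hz).continuousAt.continuousWithinAt) ?_
  rintro z ⟨⟨h1, h2⟩, -⟩
  exact key z ⟨Metric.ball_subset_closedBall h1, fun h3 => h2 (Metric.ball_subset_closedBall h3)⟩

lemma rz_mul_res {A : Type*} [NormedRing A] [NormedAlgebra ℂ A]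
    {s : A} {z : ℂ} (hz : z ∈ resolventSet ℂ s) :
    s * resolvent s z = z • resolvent s z - 1 := by
  have h := Ring.mul_inverse_cancel _ hz
  rw [sub_mul, Algebra.algebraMap_eq_smul_one, smul_mul_assoc, one_mul] at h
  unfold resolvent
  rw [Algebra.algebraMap_eq_smul_one, eq_sub_iff_add_eq, ← eq_sub_iff_add_eq']
  exact h.symm

lemma rz_res_mul {A : Type*} [NormedRing A] [NormedAlgebra ℂ A]
    {s : A} {z : ℂ} (hz : z ∈ resolventSet ℂ s) :
    resolvent s z * s = z • resolvent s z - 1 := by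
  have h := Ring.inverse_mul_cancel _ hz
  rw [mul_sub, Algebra.algebraMap_eq_smul_one, mul_smul_comm, mul_one] at h
  unfold resolvent
  rw [Algebra.algebraMap_eq_smul_one, eq_sub_iff_add_eq, ← eq_sub_iff_add_eq']
  exact h.symm

/-- Resolvent identity. -/
lemma rz_ident {A : Type*} [NormedRing A] [NormedAlgebra ℂ A]
    {s : A} {z w : ℂ} (hz : z ∈ resolventSet ℂ s) (hw : w ∈ resolventSet ℂ s) :
    (z - w) • (resolvent s w * resolvent s z) = resolvent s w - resolvent s z := by
  have h1 : resolvent s w * (s * resolvent s z) = (resolvent s w * s) * resolvent s z :=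
    (mul_assoc _ _ _).symm
  rw [rz_mul_res hz, rz_res_mul hw, mul_sub, sub_mul, mul_smul_comm, smul_mul_assoc, mul_one,
    one_mul] at h1
  rw [sub_smul]
  rw [sub_eq_sub_iff_add_eq_add] at h1 ⊢
  rw [add_comm (resolvent s w), ← h1, add_comm]

/-- The Riesz idempotent. -/
noncomputable def rz {A : Type*} [NormedRing A] [NormedAlgebra ℂ A]
    (s : A) (lam : ℂ) (r : ℝ) : A :=
  ((2 * Real.pi * Complex.I)⁻¹ : ℂ) • circleIntegral (resolvent s) lam r

lemma rz_T {A : Type*} [NormedRing A] [NormedAlgebra ℂ A] [CompleteSpace A]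
    {s : A} {lam : ℂ} {r : ℝ} (h : RzIso s lam r) (hr : 0 < r) (c : ℂ)
    (hc : c ∉ Metric.sphere lam r) :
    ∃ T : A, (s - c • 1) * T = rz s lam r -
      ((2 * Real.pi * Complex.I)⁻¹ * circleIntegral (fun z => (z - c)⁻¹) lam r : ℂ) • 1 ∧
      T * (s - c • 1) = rz s lam r -
      ((2 * Real.pi * Complex.I)⁻¹ * circleIntegral (fun z => (z - c)⁻¹) lam r : ℂ) • 1 := by
  have hne : ∀ z ∈ Metric.sphere lam r, z - c ≠ 0 := by
    intro z hz h0
    rw [sub_eq_zero] at h0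
    exact hc (h0 ▸ hz)
  have hic : ContinuousOn (fun z : ℂ => (z - c)⁻¹) (Metric.sphere lam r) :=
    (continuousOn_id.sub continuousOn_const).inv₀ hne
  have hci : CircleIntegrable (fun z => (z - c)⁻¹ • resolvent s z) lam r :=
    (hic.smul (rz_contOn h hr)).circleIntegrable hr.le
  have hcr : CircleIntegrable (resolvent s) lam r := (rz_contOn h hr).circleIntegrable hr.le
  have hc1 : CircleIntegrable (fun z : ℂ => (z - c)⁻¹ • (1 : A)) lam r :=
    (hic.smul continuousOn_const).circleIntegrable hr.le
  have e : circleIntegral (fun z => resolvent s z - (z - c)⁻¹ • (1 : A)) lam r =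
      circleIntegral (resolvent s) lam r - circleIntegral (fun z => (z - c)⁻¹) lam r • (1:A) := by
    rw [circleIntegral.integral_sub hcr hc1, circleIntegral.integral_smul_const]
  refine ⟨((2 * Real.pi * Complex.I)⁻¹ : ℂ) •
    circleIntegral (fun z => (z - c)⁻¹ • resolvent s z) lam r, ?_, ?_⟩
  · rw [mul_smul_comm, ← rz_mul_left _ hci, rz, mul_smul, ← smul_sub, ← e]
    congr 1
    refine circleIntegral.integral_congr hr.le fun z hz => ?_
    have h1 := hne z hz
    simp only [mul_smul_comm, sub_mul, smul_mul_assoc, one_mul,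
      rz_mul_res (rz_res_sphere h hr hz)]
    rw [show z • resolvent s z - 1 - c • resolvent s z = (z - c) • resolvent s z - 1 by
      rw [sub_smul]; abel, smul_sub, smul_smul, inv_mul_cancel₀ h1, one_smul]
  · rw [smul_mul_assoc, ← rz_mul_right _ hci, rz, mul_smul, ← smul_sub, ← e]
    congr 1
    refine circleIntegral.integral_congr hr.le fun z hz => ?_
    have h1 := hne z hz
    simp only [mul_smul_comm, mul_sub, smul_mul_assoc, mul_one,
      rz_res_mul (rz_res_sphere h hr hz)]
    rw [← smul_comm (z - c)⁻¹ c, ← smul_sub,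
      show z • resolvent s z - 1 - c • resolvent s z = (z - c) • resolvent s z - 1 by
      rw [sub_smul]; abel, smul_sub, smul_smul, inv_mul_cancel₀ h1, one_smul]

lemma rz_factor {A : Type*} [NormedRing A] [NormedAlgebra ℂ A] [CompleteSpace A]
    {s : A} {lam : ℂ} {r : ℝ} (h : RzIso s lam r) (hr : 0 < r) (hlt : r < ‖lam‖) :
    ∃ T : A, s * T = rz s lam r ∧ T * s = rz s lam r := by
  obtain ⟨T, h1, h2⟩ := rz_T h hr 0 (by simp; exact hlt.ne')
  have h0 : circleIntegral (fun z : ℂ => (z - 0)⁻¹) lam r = 0 := by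
    have hne : ∀ z ∈ Metric.closedBall lam r, z - 0 ≠ 0 := by
      intro z hz h0
      rw [sub_zero] at h0
      subst h0
      simp at hz
      linarith
    refine Complex.circleIntegral_eq_zero_of_differentiable_on_off_countable hr.le
      Set.countable_empty ((continuousOn_id.sub continuousOn_const).inv₀ hne) ?_
    rintro z ⟨hz, -⟩
    exact (differentiableAt_id.sub_const 0).inv (hne z (Metric.ball_subset_closedBall hz))
  rw [h0] at h1 h2
  refine ⟨T, by simpa using h1, by simpa using h2⟩

lemma rz_ne_zero {A : Type*} [NormedRing A] [NormedAlgebra ℂ A] [CompleteSpace A]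
    {s : A} {lam : ℂ} {r : ℝ} (h : RzIso s lam r) (hr : 0 < r) (hm : lam ∈ spectrum ℂ s) :
    rz s lam r ≠ 0 := by
  intro h0
  obtain ⟨T, h1, h2⟩ := rz_T h hr lam (by simp; exact hr.ne)
  rw [circleIntegral.integral_sub_center_inv _ hr.ne', h0, inv_mul_cancel₀ (by simp)] at h1 h2
  refine hm (spectrum.mem_resolventSet_of_left_right_inverse (b := T) (c := T) ?_ ?_)
  · rw [Algebra.algebraMap_eq_smul_one, ← neg_sub, neg_mul, h1]; simp
  · rw [Algebra.algebraMap_eq_smul_one, ← neg_sub, mul_neg, h2]; simp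

lemma rz_cauchy_diff {A : Type*} [NormedRing A] [NormedAlgebra ℂ A] [CompleteSpace A]
    {f : ℂ → A} {lam : ℂ} {r : ℝ} (hr : 0 < r) (hcr : CircleIntegrable f lam r) :
    DifferentiableOn ℂ (fun w => (2 * Real.pi * Complex.I : ℂ)⁻¹ •
      circleIntegral (fun z => (z - w)⁻¹ • f z) lam r) (Metric.ball lam r) := by
  lift r to NNReal using hr.le
  have := (hasFPowerSeriesOn_cauchy_integral hcr (by exact_mod_cast hr)).differentiableOn
  rwa [Metric.eball_coe] at this

lemma rz_idem {A : Type*} [NormedRing A] [NormedAlgebra ℂ A] [CompleteSpace A]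
    {s : A} {lam : ℂ} {r : ℝ} (h : RzIso s lam r) (hr : 0 < r) :
    rz s lam r * rz s lam r = rz s lam r := by
  have hr2 : 0 < r / 2 := by linarith
  have h' : RzIso s lam (r/2) := fun μ hμ hl => h μ hμ (by linarith)
  have hcr : CircleIntegrable (resolvent s) lam r := (rz_contOn h hr).circleIntegrable hr.le
  have hcr' : CircleIntegrable (resolvent s) lam (r/2) :=
    (rz_contOn h' hr2).circleIntegrable hr2.le
  have hpi : (2 * Real.pi * Complex.I : ℂ) ≠ 0 := by simp
  set G : ℂ → A := fun w => (2 * Real.pi * Complex.I : ℂ)⁻¹ •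
    circleIntegral (fun z => (z - w)⁻¹ • resolvent s z) lam r with hG
  have hGd : DifferentiableOn ℂ G (Metric.ball lam r) := by
    exact rz_cauchy_diff hr hcr
  have hsub : Metric.closedBall lam (r/2) ⊆ Metric.ball lam r :=
    Metric.closedBall_subset_ball (by linarith)
  have hG0 : circleIntegral G lam (r/2) = 0 := by
    refine Complex.circleIntegral_eq_zero_of_differentiable_on_off_countable hr2.le
      Set.countable_empty (hGd.continuousOn.mono hsub) ?_
    rintro z ⟨hz, -⟩
    exact hGd.differentiableAt (Metric.isOpen_ball.mem_nhds
      (hsub (Metric.ball_subset_closedBall hz)))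
  have hGi : CircleIntegrable G lam (r/2) :=
    (hGd.continuousOn.mono (Metric.sphere_subset_closedBall.trans hsub)).circleIntegrable hr2.le
  have key : ∀ w ∈ Metric.sphere lam (r/2), resolvent s w * rz s lam r = resolvent s w - G w := by
    intro w hw
    have hwb : w ∈ Metric.ball lam r := hsub (Metric.sphere_subset_closedBall hw)
    have hne : ∀ z ∈ Metric.sphere lam r, z - w ≠ 0 := by
      intro z hz h0
      rw [sub_eq_zero] at h0
      subst h0
      simp at hz hw
      linarith
    have hic : ContinuousOn (fun z : ℂ => (z - w)⁻¹) (Metric.sphere lam r) :=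
      (continuousOn_id.sub continuousOn_const).inv₀ hne
    have hci : CircleIntegrable (fun z => (z - w)⁻¹ • resolvent s z) lam r :=
      (hic.smul (rz_contOn h hr)).circleIntegrable hr.le
    have hc1 : CircleIntegrable (fun z : ℂ => (z - w)⁻¹ • resolvent s w) lam r :=
      (hic.smul continuousOn_const).circleIntegrable hr.le
    have e1 : circleIntegral (fun z => resolvent s w * resolvent s z) lam r =
        circleIntegral (fun z => (z - w)⁻¹ • resolvent s w - (z - w)⁻¹ • resolvent s z) lam r := by
      refine circleIntegral.integral_congr hr.le fun z hz => ?_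
      rw [← smul_sub, ← rz_ident (rz_res_sphere h hr hz) (rz_res_sphere h' hr2 hw), smul_smul,
        inv_mul_cancel₀ (hne z hz), one_smul]
    rw [rz, mul_smul_comm, ← rz_mul_left _ hcr, e1, circleIntegral.integral_sub hc1 hci,
      circleIntegral.integral_smul_const, circleIntegral.integral_sub_inv_of_mem_ball hwb,
      smul_sub, smul_smul, inv_mul_cancel₀ hpi, one_smul]
  have e2 : rz s lam r = rz s lam (r/2) := by
    rw [rz, rz, rz_radius h hr2 (by linarith)]
  calc rz s lam r * rz s lam r = rz s lam (r/2) * rz s lam r := by rw [← e2]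
    _ = rz s lam (r/2) := by
      conv_lhs => rw [rz]
      rw [smul_mul_assoc, ← rz_mul_right _ hcr']
      rw [circleIntegral.integral_congr hr2.le (fun w hw => key w hw),
        circleIntegral.integral_sub hcr' hGi, hG0, sub_zero, rz]
    _ = _ := e2.symm

section algebraic

variable {A : Type*} [NormedRing A] [NormedAlgebra ℂ A]

lemma al_corner_spec {e x : A} (hx : e * x = x) :
    spectrum ℂ x \ {0} = spectrum ℂ (x * e) \ {0} := by
  conv_lhs => rw [← hx]
  exact spectrum.nonzero_mul_comm e x

lemma al_sub_zero_of {x y : A} (h : spectrum ℂ x \ {0} = spectrum ℂ y \ {0})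
    (hy : spectrum ℂ y ⊆ {0}) : spectrum ℂ x ⊆ {0} := by
  rw [← Set.sdiff_eq_empty] at hy ⊢
  rw [h, hy]

variable [CompleteSpace A]

/-- A nonzero spectral value yields a nonzero idempotent divisible by the element. -/
lemma al_exists_idem (J : TwoSidedIdeal A)
    (hJ : ∀ s ∈ J, ∀ ε : ℝ, 0 < ε → {μ ∈ spectrum ℂ s | ε ≤ ‖μ‖}.Finite)
    {x : A} (hx : x ∈ J) {μ : ℂ} (hμ : μ ∈ spectrum ℂ x) (h0 : μ ≠ 0) :
    ∃ q T : A, q * q = q ∧ q ≠ 0 ∧ x * T = q ∧ T * x = q := by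
  have hpos : 0 < ‖μ‖ := norm_pos_iff.mpr h0
  have hfin := (hJ x hx (‖μ‖ / 2) (by linarith)).subset (Set.sdiff_subset (t := {μ}))
  have hopen := hfin.isClosed.isOpen_compl.mem_nhds (x := μ) (by simp)
  obtain ⟨δ, hδ, hb⟩ := Metric.mem_nhds_iff.mp hopen
  set r := min (δ / 2) (‖μ‖ / 2) with hrdef
  have hr : 0 < r := lt_min (by linarith) (by linarith)
  have hr1 : r ≤ δ / 2 := min_le_left _ _
  have hr2 : r ≤ ‖μ‖ / 2 := min_le_right _ _
  have hiso : RzIso x μ r := by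
    intro ν hν hle
    by_contra hne
    have h1 : ν ∈ Metric.ball μ δ := by
      rw [mem_ball_iff_norm]; linarith
    refine hb h1 ⟨⟨hν, ?_⟩, hne⟩
    have := norm_sub_norm_le μ ν
    rw [norm_sub_rev] at this
    linarith
  obtain ⟨T, h1, h2⟩ := rz_factor hiso hr (by linarith)
  exact ⟨_, T, rz_idem hiso hr, rz_ne_zero hiso hr hμ, h1, h2⟩

lemma al_not_qnil {e x U : A} (he0 : e ≠ 0) (hx : e * x = x)
    (h1 : x * U = e) (h2 : U * x = e) (hq : spectrum ℂ x ⊆ {0}) : False := by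
  have hee : e * e = e := by
    nth_rewrite 2 [← h1]
    rw [← mul_assoc, hx, h1]
  have hpow : ∀ n : ℕ, x ^ (n + 1) * U ^ (n + 1) = e := by
    intro n
    induction n with
    | zero => simpa using h1
    | succ n ih =>
      rw [pow_succ', pow_succ U, mul_assoc, ← mul_assoc (x ^ (n+1)), ih, ← mul_assoc]
      have : x * e = x := by rw [← h2, ← mul_assoc, h1, hx]
      rw [this, h1]
  have hrad : spectralRadius ℂ x = 0 := by
    unfold spectralRadius
    simp only [ENNReal.iSup_eq_zero]
    intro k hk
    have := hq hk
    simp at this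
    simp [this]
  have hg := spectrum.pow_norm_pow_one_div_tendsto_nhds_spectralRadius x
  rw [hrad] at hg
  set ε : ℝ := 1 / (2 * (‖U‖ + 1)) with hε
  have hUn := norm_nonneg U
  have hεpos : 0 < ε := by positivity
  have hev := hg.eventually (gt_mem_nhds (ENNReal.ofReal_pos.mpr hεpos))
  have hlim : Filter.Tendsto (fun n : ℕ => (1 / 2 : ℝ) ^ n) Filter.atTop (nhds 0) :=
    tendsto_pow_atTop_nhds_zero_of_lt_one (by norm_num) (by norm_num)
  have hle : ‖e‖ ≤ 0 := by
    refine ge_of_tendsto hlim ?_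
    filter_upwards [hev, Filter.eventually_ge_atTop 1] with n hn hn1
    rw [ENNReal.ofReal_lt_ofReal_iff hεpos] at hn
    have hxn : ‖x ^ n‖ ≤ ε ^ n := by
      have h3 := pow_le_pow_left₀ (by positivity) hn.le n
      rwa [one_div, Real.rpow_inv_natCast_pow (norm_nonneg _) (by omega)] at h3
    obtain ⟨m, rfl⟩ : ∃ m, n = m + 1 := ⟨n - 1, by omega⟩
    calc ‖e‖ = ‖x ^ (m+1) * U ^ (m+1)‖ := by rw [hpow]
      _ ≤ ‖x ^ (m+1)‖ * ‖U ^ (m+1)‖ := norm_mul_le _ _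
      _ ≤ ε ^ (m+1) * ‖U‖ ^ (m+1) := by
        gcongr
        exact norm_pow_le' U (Nat.succ_pos m)
      _ = (ε * ‖U‖) ^ (m+1) := by rw [mul_pow]
      _ ≤ (1/2) ^ (m+1) := by
        gcongr
        rw [hε, div_mul_eq_mul_div, div_le_div_iff₀ (by positivity) (by norm_num)]
        linarith
  exact he0 (norm_le_zero_iff.mp hle)

/-- A primitive idempotent of the ideal is minimal. -/
lemma al_prim_min (hss : ∀ a : A, (∀ x : A, spectrum ℂ (a * x) ⊆ {0}) → a = 0)
    (J : TwoSidedIdeal A)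
    (hJ : ∀ s ∈ J, ∀ ε : ℝ, 0 < ε → {μ ∈ spectrum ℂ s | ε ≤ ‖μ‖}.Finite)
    {e : A} (hee : e * e = e) (heJ : e ∈ J) (he0 : e ≠ 0)
    (hprim : ∀ g : A, g * g = g → e * g = g → g * e = g → g = 0 ∨ g = e) (a : A) :
    ∃ c : ℂ, e * a * e = c • e := by
  have dich : ∀ x : A, e * x = x → x * e = x →
      spectrum ℂ x ⊆ {0} ∨ ∃ T : A, x * T = e := by
    intro x h1 h2
    by_contra! hc
    obtain ⟨hc1, hc2⟩ := hc
    obtain ⟨μ, hμ, hμ0⟩ := Set.not_subset.mp hc1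
    have hxJ : x ∈ J := by rw [← h1]; exact J.mul_mem_right _ _ heJ
    obtain ⟨q, T, hq, hq0, hT1, hT2⟩ := al_exists_idem J hJ hxJ hμ hμ0
    rcases hprim q hq (by rw [← hT1, ← mul_assoc, h1]) (by rw [← hT2, mul_assoc, h2]) with h | h
    · exact hq0 h
    · exact hc2 T (hT1.trans h)
  have zero_of : ∀ x : A, e * x = x → x * e = x → (∀ U : A, x * U ≠ e) → x = 0 := by
    intro x h1 h2 hU
    refine hss x fun z => ?_
    refine al_sub_zero_of (al_corner_spec (e := e) (by rw [← mul_assoc, h1])) ?_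
    rcases dich (x * z * e) (by rw [← mul_assoc, ← mul_assoc, h1])
      (by rw [mul_assoc, hee]) with h | ⟨T, hT⟩
    · exact h
    · refine absurd ?_ (hU (z * e * T))
      rw [← mul_assoc, ← mul_assoc, hT]
  have two_sided : ∀ x U : A, e * x = x → x * e = x → x * U = e →
      ∃ V : A, e * V = V ∧ V * e = V ∧ x * V = e ∧ V * x = e := by
    intro x U h1 h2 h3
    have h4 : x * (e * U * e) = e := by
      rw [← mul_assoc, ← mul_assoc, h2, h3, hee]
    have h5 : e * (e * U * e) = e * U * e := by rw [← mul_assoc, ← mul_assoc, hee]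
    have h6 : (e * U * e) * e = e * U * e := by rw [mul_assoc, hee]
    generalize e * U * e = V at h4 h5 h6
    refine ⟨V, h5, h6, h4, ?_⟩
    rcases hprim (V * x) (by rw [mul_assoc, ← mul_assoc x, h4, h1])
      (by rw [← mul_assoc, h5]) (by rw [mul_assoc, h2]) with h | h
    · exfalso
      apply he0
      calc e = (x * V) * (x * V) := by rw [h4, hee]
        _ = x * (V * x) * V := by simp only [mul_assoc]
        _ = 0 := by rw [h]; simp
    · exact h
  set x := e * a * e with hx
  have h1 : e * x = x := by rw [hx, ← mul_assoc, ← mul_assoc, hee]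
  have h2 : x * e = x := by rw [hx, mul_assoc, hee]
  by_cases hq : spectrum ℂ x ⊆ {0}
  · refine ⟨0, ?_⟩
    rw [zero_smul]
    refine zero_of x h1 h2 fun U hU => ?_
    obtain ⟨V, -, -, hV3, hV4⟩ := two_sided x U h1 h2 hU
    exact al_not_qnil he0 h1 hV3 hV4 hq
  · obtain ⟨μ, hμ, hμ0⟩ := Set.not_subset.mp hq
    have hμ0 : μ ≠ 0 := hμ0
    refine ⟨μ, ?_⟩
    have k1 : e * (x - μ • e) = x - μ • e := by rw [mul_sub, h1, mul_smul_comm, hee]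
    have k2 : (x - μ • e) * e = x - μ • e := by rw [sub_mul, h2, smul_mul_assoc, hee]
    rw [← sub_eq_zero]
    refine zero_of _ k1 k2 fun U hU => ?_
    obtain ⟨V, hV1, hV2, hV3, hV4⟩ := two_sided _ U k1 k2 hU
    have i1 : x * V = e + μ • V := by
      rw [← hV3, sub_mul, smul_mul_assoc, hV1]; abel
    have i2 : V * x = e + μ • V := by
      rw [← hV4, mul_sub, mul_smul_comm, hV2]; abel
    refine hμ (spectrum.mem_resolventSet_of_left_right_inverse
      (b := μ⁻¹ • (1 - e) - V) (c := μ⁻¹ • (1 - e) - V) ?_ ?_)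
    · rw [Algebra.algebraMap_eq_smul_one]
      simp only [sub_mul, mul_sub, mul_smul_comm, smul_mul_assoc, one_mul, mul_one, h2, i1,
        smul_smul, mul_inv_cancel₀ hμ0, one_smul, sub_self, smul_zero]
      simp only [smul_sub, smul_smul, mul_inv_cancel₀ hμ0, inv_mul_cancel₀ hμ0, one_smul]
      abel
    · rw [Algebra.algebraMap_eq_smul_one]
      simp only [sub_mul, mul_sub, mul_smul_comm, smul_mul_assoc, one_mul, mul_one, h1, i2,
        smul_smul, mul_inv_cancel₀ hμ0, one_smul, sub_self, smul_zero]
      simp only [smul_sub, smul_smul, mul_inv_cancel₀ hμ0, inv_mul_cancel₀ hμ0, one_smul]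
      abel

lemma al_no_seq (J : TwoSidedIdeal A)
    (hJ : ∀ s ∈ J, ∀ ε : ℝ, 0 < ε → {μ ∈ spectrum ℂ s | ε ≤ ‖μ‖}.Finite)
    (F : ℕ → A) (hF : ∀ m n, m ≤ n → F m * F n = F n ∧ F n * F m = F n)
    (hne : ∀ n, F (n + 1) ≠ F n) (h0 : F 0 ∈ J) : False := by
  set e : ℕ → A := fun n => F n - F (n + 1) with he
  have hidem : ∀ n, e n * e n = e n := by
    intro n
    simp only [he, mul_sub, sub_mul, (hF n n le_rfl).1, (hF n (n+1) (by omega)).1,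
      (hF n (n+1) (by omega)).2, (hF (n+1) (n+1) le_rfl).1]
    abel
  have horth : ∀ m n, m ≠ n → e m * e n = 0 := by
    intro m n hmn
    rcases lt_or_gt_of_ne hmn with h | h
    · simp only [he, mul_sub, sub_mul, (hF m n (by omega)).1, (hF m (n+1) (by omega)).1,
        (hF (m+1) n (by omega)).1, (hF (m+1) (n+1) (by omega)).1]
      abel
    · simp only [he, mul_sub, sub_mul, (hF n m (by omega)).2, (hF n (m+1) (by omega)).2,
        (hF (n+1) m (by omega)).2, (hF (n+1) (m+1) (by omega)).2]
      abel
  have hp : ∀ n, F 0 * e n = e n := by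
    intro n
    simp only [he, mul_sub, (hF 0 n (by omega)).1, (hF 0 (n+1) (by omega)).1]
  have hen : ∀ n, e n ≠ 0 := fun n h => hne n (sub_eq_zero.mp h).symm
  set D : ℕ → ℝ := fun n => 1 + ∑ i ∈ Finset.range (n + 1), ‖e i‖ with hD
  have hD1 : ∀ n, 1 ≤ D n := fun n => by
    have : 0 ≤ ∑ i ∈ Finset.range (n + 1), ‖e i‖ := Finset.sum_nonneg fun _ _ => norm_nonneg _
    simp only [hD]; linarith
  have hDe : ∀ n, ‖e n‖ ≤ D n := fun n => by
    have : ‖e n‖ ≤ ∑ i ∈ Finset.range (n + 1), ‖e i‖ :=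
      Finset.single_le_sum (f := fun i => ‖e i‖) (fun _ _ => norm_nonneg _)
        (Finset.self_mem_range_succ n)
    simp only [hD]; linarith
  have hDs : ∀ n, D n ≤ D (n + 1) := fun n => by
    simp only [hD]
    rw [Finset.sum_range_succ _ (n + 1)]
    have := norm_nonneg (e (n+1))
    linarith
  set c : ℕ → ℝ := fun n => (1 / 2) ^ n / D n with hc
  have hcpos : ∀ n, 0 < c n := fun n => div_pos (by positivity) (by linarith [hD1 n])
  have hanti : StrictAnti c := by
    refine strictAnti_nat_of_succ_lt fun n => ?_
    have h1 := hD1 n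
    simp only [hc]
    refine div_lt_div₀ ?_ (hDs n) (by positivity) (by linarith)
    rw [pow_succ]
    have : (0:ℝ) < (1/2)^n := by positivity
    linarith
  have hsum : Summable fun n => (c n : ℂ) • e n := by
    refine Summable.of_norm_bounded (g := fun n : ℕ => (1 / 2 : ℝ) ^ n)
      (summable_geometric_of_lt_one (by norm_num) (by norm_num)) fun n => ?_
    rw [norm_smul, Complex.norm_real, Real.norm_of_nonneg (hcpos n).le]
    simp only [hc]
    have h1 := hD1 n
    rw [div_mul_eq_mul_div, div_le_iff₀ (by linarith)]
    exact mul_le_mul_of_nonneg_left (hDe n) (by positivity)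
  set x : A := F 0 + ∑' n, (c n : ℂ) • e n with hx
  have hxJ : x ∈ J := by
    have : x = F 0 * x := by
      rw [hx, mul_add, (hF 0 0 le_rfl).1, ← hsum.tsum_mul_left]
      simp only [mul_smul_comm, hp]
    rw [this]
    exact J.mul_mem_right _ _ h0
  have hxe : ∀ n, x * e n = ((1 + c n : ℝ) : ℂ) • e n := by
    intro n
    rw [hx, add_mul, hp, ← hsum.tsum_mul_right, tsum_eq_single n]
    · rw [smul_mul_assoc, hidem]
      push_cast
      rw [add_smul, one_smul]
    · intro m hm
      rw [smul_mul_assoc, horth m n hm, smul_zero]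
  have hspec : ∀ n, ((1 + c n : ℝ) : ℂ) ∈ spectrum ℂ x := by
    intro n hn
    apply hen n
    have hn' : IsUnit (algebraMap ℂ A ((1 + c n : ℝ) : ℂ) - x) := hn
    rw [← hn'.mul_right_eq_zero, sub_mul, hxe, Algebra.algebraMap_eq_smul_one, smul_mul_assoc,
      one_mul, sub_self]
  refine Set.infinite_of_injective_forall_mem (f := fun n => ((1 + c n : ℝ) : ℂ)) ?_
    (fun n => ?_) (hJ x hxJ 1 one_pos)
  · intro m n hmn
    have : (1 + c m : ℝ) = 1 + c n := Complex.ofReal_injective hmn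
    exact hanti.injective (by linarith)
  · refine ⟨hspec n, ?_⟩
    rw [Complex.norm_real, Real.norm_of_nonneg (by linarith [hcpos n])]
    linarith [hcpos n]

/-- Minimal idempotents. -/
def alMin (A : Type*) [NormedRing A] [NormedAlgebra ℂ A] : Set A :=
  {e | e * e = e ∧ ∀ a : A, ∃ c : ℂ, e * a * e = c • e}

lemma al_step (hss : ∀ a : A, (∀ x : A, spectrum ℂ (a * x) ⊆ {0}) → a = 0)
    (J : TwoSidedIdeal A)
    (hJ : ∀ s ∈ J, ∀ ε : ℝ, 0 < ε → {μ ∈ spectrum ℂ s | ε ≤ ‖μ‖}.Finite)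
    (f : A) (hf : f * f = f) (hfJ : f ∈ J) (hb : f ∉ AddSubmonoid.closure (alMin A)) :
    ∃ h : A, h * h = h ∧ f * h = h ∧ h * f = h ∧ h ∉ AddSubmonoid.closure (alMin A) ∧ h ≠ f := by
  have hf0 : f ≠ 0 := by
    rintro rfl
    exact hb (zero_mem _)
  by_cases hprim : ∀ g : A, g * g = g → f * g = g → g * f = g → g = 0 ∨ g = f
  · have hm : f ∈ alMin A := ⟨hf, al_prim_min hss J hJ hf hfJ hf0 hprim⟩
    exact absurd (AddSubmonoid.subset_closure hm) hb
  · push Not at hprim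
    obtain ⟨g, hg, h1, h2, hg0, hgf⟩ := hprim
    by_cases hgb : g ∈ AddSubmonoid.closure (alMin A)
    · refine ⟨f - g, ?_, ?_, ?_, ?_, ?_⟩
      · simp only [mul_sub, sub_mul, hf, h1, h2, hg]; abel
      · simp only [mul_sub, hf, h1]
      · simp only [sub_mul, hf, h2]
      · intro hc
        apply hb
        have := add_mem hc hgb
        rwa [sub_add_cancel] at this
      · intro hc
        exact hg0 (by simpa using hc)
    · exact ⟨g, hg, h1, h2, hgb, hgf⟩

lemma al_good (hss : ∀ a : A, (∀ x : A, spectrum ℂ (a * x) ⊆ {0}) → a = 0)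
    (J : TwoSidedIdeal A)
    (hJ : ∀ s ∈ J, ∀ ε : ℝ, 0 < ε → {μ ∈ spectrum ℂ s | ε ≤ ‖μ‖}.Finite)
    (p : A) (hp : p * p = p) (hpJ : p ∈ J) : p ∈ AddSubmonoid.closure (alMin A) := by
  by_contra hb
  let S := {f : A // f * f = f ∧ f ∈ J ∧ f ∉ AddSubmonoid.closure (alMin A)}
  have step : ∀ f : S, ∃ h : S, f.1 * h.1 = h.1 ∧ h.1 * f.1 = h.1 ∧ h.1 ≠ f.1 := by
    rintro ⟨f, hf, hfJ, hfb⟩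
    obtain ⟨h, h1, h2, h3, h4, h5⟩ := al_step hss J hJ f hf hfJ hfb
    exact ⟨⟨h, h1, by rw [← h2]; exact J.mul_mem_right _ _ hfJ, h4⟩, h2, h3, h5⟩
  choose nx hn1 hn2 hn3 using step
  let F : ℕ → S := fun n => Nat.rec ⟨p, hp, hpJ, hb⟩ (fun _ f => nx f) n
  have hFs : ∀ n, F (n + 1) = nx (F n) := fun n => rfl
  refine al_no_seq J hJ (fun n => (F n).1) ?_ (fun n => hn3 (F n)) hpJ
  intro m n hmn
  induction n, hmn using Nat.le_induction with
  | base => exact ⟨(F m).2.1, (F m).2.1⟩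
  | succ n hmn ih =>
    simp only [hFs] at ih ⊢
    constructor
    · rw [← hn1 (F n), ← mul_assoc, ih.1]
    · rw [← hn2 (F n), mul_assoc, ih.2]

end algebraic

/-- The linear map `a ↦ f a g`. -/
noncomputable def alMap {A : Type*} [NormedRing A] [NormedAlgebra ℂ A] (f g : A) : A →ₗ[ℂ] A :=
  LinearMap.mulLeftRight ℂ (f, g)

lemma al_map_apply {A : Type*} [NormedRing A] [NormedAlgebra ℂ A] (f g a : A) :
    alMap f g a = f * a * g := by
  simp [alMap]

lemma al_dim_one {A : Type*} [NormedRing A] [NormedAlgebra ℂ A]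
    (hss : ∀ a : A, (∀ x : A, spectrum ℂ (a * x) ⊆ {0}) → a = 0)
    {e f : A} (he : e ∈ alMin A) (hf : f ∈ alMin A) :
    FiniteDimensional ℂ (LinearMap.range (alMap e f)) := by
  obtain ⟨hee, hem⟩ := he
  obtain ⟨hff, hfm⟩ := hf
  by_cases hz : ∀ a : A, e * a * f = 0
  · have : alMap e f = 0 := by
      ext a
      rw [al_map_apply, hz a]; rfl
    rw [this, LinearMap.range_zero]
    infer_instance
  · push Not at hz
    obtain ⟨a, ha⟩ := hz
    have : ∃ z : A, ¬ spectrum ℂ ((e * a * f) * z) ⊆ {0} := by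
      by_contra! hc
      exact ha (hss _ hc)
    obtain ⟨z, hz⟩ := this
    obtain ⟨c, hc⟩ := hem (a * f * z)
    have hc' : e * a * f * z * e = c • e := by rw [← hc]; simp only [mul_assoc]
    have hc0 : c ≠ 0 := by
      rintro rfl
      apply hz
      refine al_sub_zero_of (al_corner_spec (e := e) ?_) (y := e * a * f * z * e) ?_
      · simp only [← mul_assoc, hee]
      · rw [hc', zero_smul]
        rcases subsingleton_or_nontrivial A with h | h
        · simp
        · rw [spectrum.zero_eq]
    refine Submodule.finiteDimensional_of_le (S₂ := Submodule.span ℂ {e * a * f}) ?_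
    rintro _ ⟨b, rfl⟩
    rw [al_map_apply, Submodule.mem_span_singleton]
    obtain ⟨d, hd⟩ := hfm (z * e * b)
    refine ⟨c⁻¹ * d, ?_⟩
    have h1 : (e * a * f * z * e) * b * f = d • (e * a * f) := by
      calc (e * a * f * z * e) * b * f = (e * a * (f * f) * z * e) * b * f := by rw [hff]
        _ = e * a * f * (f * (z * e * b) * f) := by simp only [mul_assoc]
        _ = d • (e * a * f) := by rw [hd, mul_smul_comm, mul_assoc, hff]
    rw [mul_smul, ← h1, hc', smul_mul_assoc, smul_mul_assoc, smul_smul, inv_mul_cancel₀ hc0,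
      one_smul]

lemma al_fin_dim {A : Type*} [NormedRing A] [NormedAlgebra ℂ A]
    (hss : ∀ a : A, (∀ x : A, spectrum ℂ (a * x) ⊆ {0}) → a = 0)
    {e f : A} (he : e ∈ AddSubmonoid.closure (alMin A))
    (hf : f ∈ AddSubmonoid.closure (alMin A)) :
    FiniteDimensional ℂ (LinearMap.range (alMap e f)) := by
  induction he using AddSubmonoid.closure_induction with
  | mem e he =>
    induction hf using AddSubmonoid.closure_induction with
    | mem f hf => exact al_dim_one hss he hf
    | zero =>
      have : alMap e 0 = 0 := by ext a; simp [al_map_apply]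
      rw [this, LinearMap.range_zero]
      infer_instance
    | add f g _ _ h1 h2 =>
      refine Submodule.finiteDimensional_of_le
        (S₂ := LinearMap.range (alMap e f) ⊔ LinearMap.range (alMap e g)) ?_
      rintro _ ⟨a, rfl⟩
      have : alMap e (f + g) a = alMap e f a + alMap e g a := by
        simp only [al_map_apply, mul_add]
      rw [this]
      exact Submodule.add_mem_sup ⟨a, rfl⟩ ⟨a, rfl⟩
  | zero =>
    have : alMap 0 f = 0 := by ext a; simp [al_map_apply]
    rw [this, LinearMap.range_zero]
    infer_instance
  | add e g _ _ h1 h2 =>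
    refine Submodule.finiteDimensional_of_le
      (S₂ := LinearMap.range (alMap e f) ⊔ LinearMap.range (alMap g f)) ?_
    rintro _ ⟨a, rfl⟩
    have : alMap (e + g) f a = alMap e f a + alMap g f a := by
      simp only [al_map_apply, add_mul]
    rw [this]
    exact Submodule.add_mem_sup ⟨a, rfl⟩ ⟨a, rfl⟩

lemma al_bound {A : Type*} [NormedRing A] [NormedAlgebra ℂ A] {V : Submodule ℂ A}
    [FiniteDimensional ℂ V] {y : A} (hy : ∀ n : ℕ, y ^ (n + 1) ∈ V) :
    (spectrum ℂ y).Finite ∧ (spectrum ℂ y).ncard ≤ Module.finrank ℂ V + 1 := by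
  classical
  set d := Module.finrank ℂ V with hd
  let v : Fin (d + 1) → V := fun i => ⟨y ^ ((i : ℕ) + 1), hy i⟩
  have hli : ¬ LinearIndependent ℂ v := by
    intro h
    have := h.fintype_card_le_finrank
    simp [← hd] at this
  rw [Fintype.not_linearIndependent_iff] at hli
  obtain ⟨g, hg, i0, hi0⟩ := hli
  let q : Polynomial ℂ := ∑ i : Fin (d + 1), Polynomial.C (g i) * Polynomial.X ^ ((i : ℕ) + 1)
  have hq0 : q ≠ 0 := by
    intro h
    apply hi0
    have h2 := congrArg (fun P => Polynomial.coeff P ((i0 : ℕ) + 1)) h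
    simp only [q, Polynomial.finset_sum_coeff, Polynomial.coeff_C_mul, Polynomial.coeff_X_pow,
      Polynomial.coeff_zero, add_left_inj, Fin.val_inj, mul_ite, mul_one, mul_zero,
      Finset.sum_ite_eq, Finset.mem_univ, if_true] at h2
    exact h2
  have hdeg : q.natDegree ≤ d + 1 := by
    refine Polynomial.natDegree_sum_le_of_forall_le _ _ fun i _ => ?_
    refine (Polynomial.natDegree_C_mul_X_pow_le _ _).trans ?_
    have := i.2
    omega
  have hqy : Polynomial.aeval y q = 0 := by
    have h2 := congrArg (Subtype.val) hg
    simp only [v, Submodule.coe_sum, Submodule.coe_smul, Submodule.coe_zero] at h2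
    simp only [q, map_sum, map_mul, Polynomial.aeval_C, map_pow, Polynomial.aeval_X]
    rw [← h2]
    exact Finset.sum_congr rfl fun i _ => (Algebra.smul_def _ _).symm
  have hsub : spectrum ℂ y ⊆ (q.roots.toFinset : Set ℂ) := by
    intro k hk
    have h3 := spectrum.subset_polynomial_aeval y q ⟨k, hk, rfl⟩
    rw [hqy] at h3
    rcases subsingleton_or_nontrivial A with h | h
    · simp at hk
    · rw [spectrum.zero_eq] at h3
      simp [hq0]
      exact h3
  refine ⟨(Finset.finite_toSet _).subset hsub, ?_⟩
  calc (spectrum ℂ y).ncard ≤ (q.roots.toFinset : Set ℂ).ncard :=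
        Set.ncard_le_ncard hsub (Finset.finite_toSet _)
    _ = q.roots.toFinset.card := Set.ncard_coe_finset _
    _ ≤ q.roots.card := Multiset.toFinset_card_le _
    _ ≤ q.natDegree := q.card_roots'
    _ ≤ d + 1 := hdeg

/-- Riesz projections of elements of an inessential ideal corresponding to nonzero
spectral values have finite rank. -/
theorem riesz_projection_finite_rank {A : Type*} [NormedRing A] [NormedAlgebra ℂ A]
    [CompleteSpace A]
    (hss : ∀ a : A, (∀ x : A, spectrum ℂ (a * x) ⊆ {0}) → a = 0)
    (J : TwoSidedIdeal A)
    (hJ : ∀ s ∈ J, ∀ ε : ℝ, 0 < ε → {μ ∈ spectrum ℂ s | ε ≤ ‖μ‖}.Finite)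
    (s : A) (hs : s ∈ J)
    (lam : ℂ) (hlam : lam ≠ 0) (hmem : lam ∈ spectrum ℂ s)
    (r : ℝ) (hr : 0 < r)
    (hiso : ∀ μ ∈ spectrum ℂ s, ‖μ - lam‖ ≤ r → μ = lam)
    (p : A)
    (hp : p = ((2 * Real.pi * Complex.I)⁻¹ : ℂ) •
        circleIntegral (fun z : ℂ => Ring.inverse (z • (1 : A) - s)) lam r) :
    ∃ N : ℕ, ∀ x : A,
      (spectrum ℂ (p * x) \ {0}).Finite ∧ (spectrum ℂ (p * x) \ {0}).ncard ≤ N := by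
  have hiso' : RzIso s lam r := hiso
  set r' := min r (‖lam‖ / 2) with hr'
  have hl : 0 < ‖lam‖ := norm_pos_iff.mpr hlam
  have hr'0 : 0 < r' := lt_min hr (by linarith)
  have hr'2 : r' ≤ ‖lam‖ / 2 := min_le_right _ _
  have hr'r : r' ≤ r := min_le_left _ _
  have hiso2 : RzIso s lam r' := fun μ hμ hle => hiso μ hμ (hle.trans hr'r)
  have hpe : p = rz s lam r' := by
    have h1 : (fun z : ℂ => Ring.inverse (z • (1 : A) - s)) = resolvent s := by
      funext z
      rw [resolvent, Algebra.algebraMap_eq_smul_one]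
    rw [hp, h1, rz, rz_radius hiso' hr'0 hr'r]
  have hpp : p * p = p := by rw [hpe]; exact rz_idem hiso2 hr'0
  have hpJ : p ∈ J := by
    obtain ⟨T, hT, -⟩ := rz_factor hiso2 hr'0 (by linarith)
    rw [hpe, ← hT]
    exact J.mul_mem_right _ _ hs
  have hgood := al_good hss J hJ p hpp hpJ
  have := al_fin_dim hss hgood hgood
  refine ⟨Module.finrank ℂ (LinearMap.range (alMap p p)) + 1, fun x => ?_⟩
  rw [al_corner_spec (e := p) (x := p * x) (by rw [← mul_assoc, hpp])]
  have h2 := al_bound (V := LinearMap.range (alMap p p)) (y := p * x * p) (by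
    intro n
    induction n with
    | zero => exact ⟨x, by rw [al_map_apply]; simp⟩
    | succ n ih =>
      obtain ⟨b, hb⟩ := ih
      refine ⟨b * p * p * x, ?_⟩
      rw [pow_succ, ← hb, al_map_apply, al_map_apply]
      simp only [mul_assoc])
  exact ⟨h2.1.subset Set.sdiff_subset, (Set.ncard_le_ncard Set.sdiff_subset h2.1).trans h2.2⟩
end
end

section
/- Let A be a complex semisimple unital Banach algebra, let {b, a₁, …, a_n} be a linearly independent set of rank one elements of A. Then there exists y ∈ A such that σ(by) ≠ {0} while σ(a_i y) = {0} for every i ∈ {1, …, n}. -/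
noncomputable section

/-- `rank a = n`. -/
def hasRank {A : Type*} [NormedRing A] [NormedAlgebra ℂ A] (a : A) (n : ℕ) : Prop :=
  rankLE a n ∧ ∃ x : A, (spectrum ℂ (x * a) \ {0}).ncard = n

open Filter Topology

/-- Lower semicontinuity of an isolated part of the spectrum. -/
theorem newburgh_aux {A : Type*} [NormedRing A] [NormedAlgebra ℂ A] [CompleteSpace A]
    (T : A) (z₀ : ℂ) (r : ℝ) (hr : 0 < r) (hz : z₀ ∈ spectrum ℂ T)
    (hs : ∀ z ∈ Metric.sphere z₀ r, z ∉ spectrum ℂ T) :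
    ∀ᶠ S in 𝓝 T, ∃ z ∈ Metric.closedBall z₀ r, z ∈ spectrum ℂ S := by
  have hcont : ∀ z ∈ Metric.sphere z₀ r,
      ContinuousAt (fun p : A × ℂ => resolvent p.1 p.2) (T, z) := by
    intro z hz
    have hu : IsUnit (algebraMap ℂ A z - T) := spectrum.notMem_iff.mp (hs z hz)
    have h1 : ContinuousAt Ring.inverse (algebraMap ℂ A z - T) := by
      have := NormedRing.inverse_continuousAt hu.unit
      simpa using this
    have h2 : ContinuousAt (fun p : A × ℂ => algebraMap ℂ A p.2 - p.1) (T, z) := by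
      have := continuous_algebraMap ℂ A
      fun_prop
    exact ContinuousAt.comp (g := Ring.inverse) h1 h2
  have hcontT : ContinuousOn (fun z => ‖resolvent T z‖) (Metric.sphere z₀ r) := by
    intro z hz
    have h2 : ContinuousAt (fun z : ℂ => ((T, z) : A × ℂ)) z := by fun_prop
    exact (ContinuousAt.comp (f := fun z : ℂ => ((T, z) : A × ℂ))
      (g := fun p : A × ℂ => resolvent p.1 p.2) (hcont z hz) h2).norm.continuousWithinAt
  obtain ⟨C, hC⟩ := (isCompact_sphere z₀ r).bddAbove_image hcontT
  have hC' : ∀ z ∈ Metric.sphere z₀ r, ‖resolvent T z‖ ≤ C := fun z hz =>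
    hC (Set.mem_image_of_mem _ hz)
  have hev : ∀ᶠ S in 𝓝 T, ∀ z ∈ Metric.sphere z₀ r, ‖resolvent S z‖ < C + 1 := by
    refine (isCompact_sphere z₀ r).eventually_forall_of_forall_eventually
      (P := fun S z => ‖resolvent S z‖ < C + 1) ?_
    intro z hz
    have := (hcont z hz).norm
    refine this.eventually_lt (continuousAt_const (y := C + 1)) ?_
    have := hC' z hz
    show ‖resolvent T z‖ < C + 1
    linarith
  have hCpos : 0 ≤ C := by
    have : (z₀ + r) ∈ Metric.sphere z₀ r := by simp [abs_of_pos hr]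
    exact (norm_nonneg _).trans (hC' _ this)
  have hnear : ∀ᶠ S in 𝓝 T, ‖S - T‖ < (C + 1)⁻¹ := by
    have := Metric.ball_mem_nhds T (show 0 < (C + 1)⁻¹ by positivity)
    filter_upwards [this] with S hS
    simpa [dist_eq_norm] using hS
  filter_upwards [hev, hnear] with S hS1 hS2
  by_contra hcon
  push Not at hcon
  have hbd : ‖resolvent S z₀‖ ≤ C + 1 := by
    refine Complex.norm_le_of_forall_mem_frontier_norm_le (U := Metric.ball z₀ r)
      (f := resolvent S) Metric.isBounded_ball ?_ ?_ ?_
    · refine DifferentiableOn.diffContOnCl ?_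
      intro z hz
      rw [closure_ball z₀ hr.ne'] at hz
      exact (spectrum.hasDerivAt_resolvent_const_left
        (spectrum.mem_resolventSet_iff.mpr
          (spectrum.notMem_iff.mp (hcon z hz)))).differentiableAt.differentiableWithinAt
    · intro z hz
      rw [frontier_ball z₀ hr.ne'] at hz
      exact (hS1 z hz).le
    · exact subset_closure (Metric.mem_ball_self hr)
  have hu : IsUnit (algebraMap ℂ A z₀ - S) :=
    spectrum.notMem_iff.mp (hcon z₀ (Metric.mem_closedBall_self hr.le))
  apply hz
  rw [spectrum.mem_resolventSet_iff]
  have hinv : resolvent S z₀ = ((hu.unit⁻¹ : Aˣ) : A) := by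
    unfold resolvent
    conv_lhs => rw [← hu.unit_spec]
    exact Ring.inverse_unit _
  rcases subsingleton_or_nontrivial A with hA | hA
  · exact isUnit_of_subsingleton _
  rw [hinv] at hbd
  refine (hu.unit.ofNearby (algebraMap ℂ A z₀ - T) ?_).isUnit
  have h0 : 0 < ‖((hu.unit⁻¹ : Aˣ) : A)‖ := norm_pos_iff.mpr (Units.ne_zero _)
  have : (algebraMap ℂ A z₀ - T) - ((hu.unit : Aˣ) : A) = S - T := by
    rw [hu.unit_spec]; abel
  rw [this]
  exact hS2.trans_le (inv_anti₀ h0 hbd)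

theorem rankLE_one_unique {A : Type*} [NormedRing A] [NormedAlgebra ℂ A] {a : A}
    (h : rankLE a 1) (x : A) {l m : ℂ} (hl : l ∈ spectrum ℂ (x * a)) (hl0 : l ≠ 0)
    (hm : m ∈ spectrum ℂ (x * a)) (hm0 : m ≠ 0) : l = m :=
  (Set.ncard_le_one_iff (h x).1).mp (h x).2 ⟨hl, hl0⟩ ⟨hm, hm0⟩

theorem isolated_aux {A : Type*} [NormedRing A] [NormedAlgebra ℂ A] [CompleteSpace A] {a : A}
    (h : rankLE a 1) (x : A) {l : ℂ} (hl : l ∈ spectrum ℂ (x * a)) (hl0 : l ≠ 0) :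
    ∀ᶠ S in 𝓝 (x * a), ∃ z ∈ Metric.closedBall l (‖l‖ / 2), z ∈ spectrum ℂ S := by
  have hpos : 0 < ‖l‖ := norm_pos_iff.mpr hl0
  refine newburgh_aux _ l (‖l‖ / 2) (by positivity) hl ?_
  intro z hz hzs
  rw [mem_sphere_iff_norm] at hz
  have hz0 : z ≠ 0 := by
    rintro rfl
    simp at hz
    linarith
  have := rankLE_one_unique h x hl hl0 hzs hz0
  subst this
  simp at hz
  linarith

theorem mul_eq_self_of_one_mem {A : Type*} [NormedRing A] [NormedAlgebra ℂ A] [CompleteSpace A]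
    (hss : ∀ a : A, (∀ x : A, spectrum ℂ (a * x) ⊆ {0}) → a = 0) {a : A}
    (h : rankLE a 1) (x : A) (hx : (1 : ℂ) ∈ spectrum ℂ (x * a)) : a * (x * a) = a := by
  suffices a - a * (x * a) = 0 from (sub_eq_zero.mp this).symm
  apply hss
  intro y l hl
  by_contra hl0
  have hl0 : l ≠ 0 := hl0
  have hl' : l ∈ spectrum ℂ (y * (a - a * (x * a))) \ {0} := by
    rw [← spectrum.nonzero_mul_comm]; exact ⟨hl, hl0⟩
  have hTeq : y * (a - a * (x * a)) = (y - y * a * x) * a := by noncomm_ring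
  rw [hTeq] at hl'
  have hN := isolated_aux h _ hl'.1 hl0
  have hpos : 0 < ‖l‖ := norm_pos_iff.mpr hl0
  have htend : Tendsto (fun e : ℂ => (y - y * a * x) * a + e • (x * a)) (𝓝[≠] 0)
      (𝓝 ((y - y * a * x) * a)) := by
    have : ContinuousAt (fun e : ℂ => (y - y * a * x) * a + e • (x * a)) 0 := by fun_prop
    have h2 := this.tendsto
    simp only [zero_smul, add_zero] at h2
    exact h2.mono_left nhdsWithin_le_nhds
  have hfin : ∀ᶠ e : ℂ in 𝓝[≠] 0, e ∉ spectrum ℂ (y * a) \ {0} := by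
    refine Filter.Eventually.filter_mono nhdsWithin_le_nhds ?_
    exact (h y).1.isClosed.isOpen_compl.mem_nhds (by simp)
  have hsmall : ∀ᶠ e : ℂ in 𝓝[≠] 0, ‖e‖ < ‖l‖ / 2 := by
    refine Filter.Eventually.filter_mono nhdsWithin_le_nhds ?_
    filter_upwards [Metric.ball_mem_nhds (0 : ℂ) (half_pos hpos)] with e he
    simpa using he
  obtain ⟨e, ⟨z, hzb, hzs⟩, hef, hes, he0⟩ :=
    ((htend.eventually hN).and (hfin.and (hsmall.and self_mem_nhdsWithin))).exists
  have he0 : e ≠ 0 := he0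
  have heu : IsUnit (algebraMap ℂ A e - y * a) := by
    apply spectrum.notMem_iff.mp
    exact fun hh => hef ⟨hh, he0⟩
  have hmem : e ∈ spectrum ℂ ((y - y * a * x) * a + e • (x * a)) := by
    rw [spectrum.mem_iff] at hx ⊢
    intro hu
    apply hx
    have heq : algebraMap ℂ A e - ((y - y * a * x) * a + e • (x * a))
        = (algebraMap ℂ A e - y * a) * (algebraMap ℂ A 1 - x * a) := by
      simp only [Algebra.algebraMap_eq_smul_one, one_smul]
      simp only [sub_mul, mul_sub, smul_mul_assoc, one_mul, mul_one, mul_assoc]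
      abel
    rw [heq] at hu
    have := (heu.unit.isUnit_units_mul (algebraMap ℂ A 1 - x * a)).mp (by simpa using hu)
    exact this
  have hSeq : (y - y * a * x) * a + e • (x * a) = (y - y * a * x + e • x) * a := by
    rw [add_mul, smul_mul_assoc]
  rw [hSeq] at hmem hzs
  rw [mem_closedBall_iff_norm] at hzb
  have hz0 : z ≠ 0 := by
    rintro rfl
    simp at hzb
    linarith
  have := rankLE_one_unique h _ hmem he0 hzs hz0
  subst this
  have := norm_sub_norm_le l e
  rw [norm_sub_rev] at this
  linarith

theorem inv_smul_mem {A : Type*} [NormedRing A] [NormedAlgebra ℂ A] {u : A} {l : ℂ}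
    (hl : l ∈ spectrum ℂ u) (hl0 : l ≠ 0) : (1 : ℂ) ∈ spectrum ℂ (l⁻¹ • u) := by
  have := (spectrum.smul_mem_smul_iff (a := u) (s := l) (r := (Units.mk0 l hl0)⁻¹)).mpr hl
  simpa [Units.smul_def, hl0] using this

theorem mul_eq_smul_of_mem {A : Type*} [NormedRing A] [NormedAlgebra ℂ A] [CompleteSpace A]
    (hss : ∀ a : A, (∀ x : A, spectrum ℂ (a * x) ⊆ {0}) → a = 0) {a : A}
    (h : rankLE a 1) (x : A) {l : ℂ} (hl : l ∈ spectrum ℂ (x * a)) (hl0 : l ≠ 0) :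
    a * (x * a) = l • a := by
  have h1 := inv_smul_mem hl hl0
  rw [← smul_mul_assoc] at h1
  have := mul_eq_self_of_one_mem hss h _ h1
  rw [smul_mul_assoc, mul_smul_comm] at this
  rw [← this, smul_smul, mul_inv_cancel₀ hl0, one_smul, this]

theorem exists_functional {A : Type*} [NormedRing A] [NormedAlgebra ℂ A] [CompleteSpace A]
    (hss : ∀ a : A, (∀ x : A, spectrum ℂ (a * x) ⊆ {0}) → a = 0) {a : A}
    (h : hasRank a 1) (ha0 : a ≠ 0) :
    ∃ τ : A →ₗ[ℂ] ℂ, ∀ z, a * z * a = τ z • a := by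
  obtain ⟨h, x, hx⟩ := h
  obtain ⟨l, hl⟩ := Set.ncard_eq_one.mp hx
  have hl' : l ∈ spectrum ℂ (x * a) \ {0} := by rw [hl]; rfl
  have hl0 : l ≠ 0 := hl'.2
  have key : ∀ w : A, ∃ t : ℂ, a * w * a = t • a := by
    intro w
    have hN := isolated_aux h x hl'.1 hl0
    have htend : Tendsto (fun e : ℂ => x * a + e • (w * a)) (𝓝[≠] 0) (𝓝 (x * a)) := by
      have : ContinuousAt (fun e : ℂ => x * a + e • (w * a)) 0 := by fun_prop
      have h2 := this.tendsto
      simp only [zero_smul, add_zero] at h2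
      exact h2.mono_left nhdsWithin_le_nhds
    obtain ⟨e, ⟨z, hzb, hzs⟩, he0⟩ := ((htend.eventually hN).and self_mem_nhdsWithin).exists
    have he0 : e ≠ 0 := he0
    have hpos : 0 < ‖l‖ := norm_pos_iff.mpr hl0
    rw [mem_closedBall_iff_norm] at hzb
    have hz0 : z ≠ 0 := by
      rintro rfl
      simp at hzb
      linarith
    rw [← smul_mul_assoc, ← add_mul] at hzs
    have h1 := mul_eq_smul_of_mem hss h _ hzs hz0
    have h2 := mul_eq_smul_of_mem hss h _ hl'.1 hl0
    refine ⟨e⁻¹ * (z - l), ?_⟩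
    rw [add_mul, mul_add, h2, smul_mul_assoc, mul_smul_comm] at h1
    have h3 : e • (a * (w * a)) = (z - l) • a := by
      rw [sub_smul, ← h1]; abel
    rw [mul_smul, ← h3, smul_smul, inv_mul_cancel₀ he0, one_smul, mul_assoc]
  choose t ht using key
  have hinj : ∀ {s r : ℂ}, s • a = r • a → s = r := fun hh => smul_left_injective ℂ ha0 hh
  refine ⟨{ toFun := t, map_add' := ?_, map_smul' := ?_ }, ht⟩
  · intro u v
    apply hinj
    rw [← ht, add_smul, ← ht, ← ht, mul_add, add_mul]
  · intro c u
    apply hinj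
    rw [← ht, RingHom.id_apply, smul_eq_mul, mul_smul, ← ht, mul_smul_comm, smul_mul_assoc]

theorem trace_comm {A : Type*} [NormedRing A] [NormedAlgebra ℂ A] {a b : A}
    (ha0 : a ≠ 0) (hb0 : b ≠ 0) {τ ρ : A →ₗ[ℂ] ℂ} (hτ : ∀ z, a * z * a = τ z • a)
    (hρ : ∀ z, b * z * b = ρ z • b) (x y : A) : ρ (x * a * y) = τ (y * b * x) := by
  have h1 : b * x * a * y * b = ρ (x * a * y) • b := by rw [← hρ]; noncomm_ring
  have h2 : a * y * b * x * a = τ (y * b * x) • a := by rw [← hτ]; noncomm_ring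
  by_cases hz : b * x * a = 0
  · have h1' : ρ (x * a * y) • b = 0 := by rw [← h1, hz]; simp
    have h2' : τ (y * b * x) • a = 0 := by
      rw [← h2, mul_assoc (a * y) b x, mul_assoc (a * y) (b * x) a, hz]; simp
    rw [(smul_eq_zero.mp h1').resolve_right hb0, (smul_eq_zero.mp h2').resolve_right ha0]
  · apply smul_left_injective ℂ hz
    show ρ (x * a * y) • (b * x * a) = τ (y * b * x) • (b * x * a)
    calc ρ (x * a * y) • (b * x * a) = (ρ (x * a * y) • b) * x * a := by
          simp only [smul_mul_assoc]
      _ = b * x * (a * y * b * x * a) := by rw [← h1]; noncomm_ring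
      _ = τ (y * b * x) • (b * x * a) := by rw [h2, mul_smul_comm]

theorem spectrum_sub_of_sq {A : Type*} [NormedRing A] [NormedAlgebra ℂ A] {u : A}
    (h : u * u = 0) : spectrum ℂ u ⊆ {0} := by
  intro l hl
  by_contra hl0
  have hl0 : l ≠ 0 := hl0
  apply hl
  rw [spectrum.mem_resolventSet_iff]
  have e1 : (algebraMap ℂ A l - u) * (algebraMap ℂ A l + u) = algebraMap ℂ A (l * l) := by
    rw [sub_mul, mul_add, mul_add, h, map_mul, Algebra.commutes l u]; abel
  have e2 : (algebraMap ℂ A l + u) * (algebraMap ℂ A l - u) = algebraMap ℂ A (l * l) := by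
    rw [add_mul, mul_sub, mul_sub, h, map_mul, Algebra.commutes l u]; abel
  have e3 : algebraMap ℂ A (l * l) * algebraMap ℂ A (l * l)⁻¹ = 1 := by
    rw [← map_mul, mul_inv_cancel₀ (mul_ne_zero hl0 hl0), map_one]
  refine ⟨⟨algebraMap ℂ A l - u, (algebraMap ℂ A l + u) * algebraMap ℂ A (l * l)⁻¹, ?_, ?_⟩, rfl⟩
  · rw [← mul_assoc, e1, e3]
  · rw [mul_assoc, Algebra.commutes, ← mul_assoc, e2, e3]

theorem zero_of_mul_zero {A : Type*} [NormedRing A] [NormedAlgebra ℂ A]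
    (hss : ∀ a : A, (∀ x : A, spectrum ℂ (a * x) ⊆ {0}) → a = 0) {c : A}
    (h : ∀ x, c * x * c = 0) : c = 0 := by
  apply hss
  intro x
  apply spectrum_sub_of_sq
  rw [← mul_assoc, h, zero_mul]

theorem sum_zero_of_trace {A : Type*} [NormedRing A] [NormedAlgebra ℂ A]
    (hss : ∀ a : A, (∀ x : A, spectrum ℂ (a * x) ⊆ {0}) → a = 0) {m : ℕ} (d : Fin m → A)
    (k : Fin m → ℂ) (hd : ∀ i, d i ≠ 0) (τ : Fin m → A →ₗ[ℂ] ℂ)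
    (hτ : ∀ i z, d i * z * d i = τ i z • d i) (hk : ∀ y, ∑ i, k i * τ i y = 0) :
    ∑ i, k i • d i = 0 := by
  set c := ∑ i, k i • d i with hc
  have h1 : ∀ j x y, d j * (x * c * y) * d j = 0 := by
    intro j x y
    rw [hτ]
    have : τ j (x * c * y) = ∑ i, k i * τ i (y * d j * x) := by
      rw [hc, Finset.mul_sum, Finset.sum_mul, map_sum]
      refine Finset.sum_congr rfl fun i _ => ?_
      rw [mul_smul_comm, smul_mul_assoc, map_smul, smul_eq_mul,
        trace_comm (hd i) (hd j) (hτ i) (hτ j)]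
    rw [this, hk, zero_smul]
  have h2 : ∀ j x, d j * x * c = 0 := by
    intro j x
    apply zero_of_mul_zero hss
    intro y
    have : d j * x * c * y * (d j * x * c) = (d j * (x * c * y) * d j) * (x * c) := by
      noncomm_ring
    rw [this, h1, zero_mul]
  apply zero_of_mul_zero hss
  intro x
  conv_lhs => enter [1, 1]; rw [hc]
  rw [Finset.sum_mul, Finset.sum_mul]
  refine Finset.sum_eq_zero fun i _ => ?_
  rw [smul_mul_assoc, smul_mul_assoc, h2, smul_zero]

/-- Given a linearly independent set `{b, a₁, …, aₙ}` of rank one elements, there is `y`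
with `σ(by) ≠ {0}` and `σ(aᵢy) = {0}` for all `i`. -/
theorem separate_rank_one_elements {A : Type*} [NormedRing A] [NormedAlgebra ℂ A]
    [CompleteSpace A]
    (hss : ∀ a : A, (∀ x : A, spectrum ℂ (a * x) ⊆ {0}) → a = 0)
    (n : ℕ) (b : A) (a : Fin n → A)
    (hb : hasRank b 1) (ha : ∀ i, hasRank (a i) 1)
    (hli : LinearIndependent ℂ (Fin.cons b a : Fin (n + 1) → A)) :
    ∃ y : A, spectrum ℂ (b * y) ≠ {0} ∧ ∀ i, spectrum ℂ (a i * y) = {0} := by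
  classical
  set d : Fin (n + 1) → A := Fin.cons b a with hd
  have hd0 : ∀ i, d i ≠ 0 := fun i => hli.ne_zero i
  have hrk : ∀ i, hasRank (d i) 1 := by
    intro i
    refine Fin.cases ?_ (fun i => ?_) i
    · simpa [hd] using hb
    · simpa [hd] using ha i
  choose τ hτ using fun i => exists_functional hss (hrk i) (hd0 i)
  have hA : Nontrivial A := ⟨⟨b, 0, by simpa [hd] using hd0 0⟩⟩
  have hex : ∃ y, (∀ i : Fin n, τ i.succ y = 0) ∧ τ 0 y ≠ 0 := by
    by_contra hcon
    push Not at hcon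
    have hmem : τ 0 ∈ Submodule.span ℂ (Set.range fun i : Fin n => τ i.succ) := by
      apply mem_span_of_iInf_ker_le_ker
      intro y hy
      rw [Submodule.mem_iInf] at hy
      exact hcon y hy
    obtain ⟨c, hc⟩ := (Submodule.mem_span_range_iff_exists_fun ℂ).mp hmem
    have hsum := sum_zero_of_trace hss d (Fin.cons 1 (fun i => - c i)) hd0 τ hτ (by
      intro y
      rw [Fin.sum_univ_succ, ← hc]
      simp)
    have := Fintype.linearIndependent_iff.mp hli _ hsum 0
    simp at this
  obtain ⟨y, hy, hy0⟩ := hex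
  refine ⟨y, ?_, ?_⟩
  · intro hsp
    have hbb : b * y * b = τ 0 y • b := by simpa [hd] using hτ 0 y
    have hb0 : b ≠ 0 := by simpa [hd] using hd0 0
    have hmem : τ 0 y ∈ spectrum ℂ (b * y) := by
      rw [spectrum.mem_iff]
      intro hu
      apply hb0
      have : (algebraMap ℂ A (τ 0 y) - b * y) * b = 0 := by
        rw [sub_mul, hbb, Algebra.algebraMap_eq_smul_one, smul_mul_assoc, one_mul, sub_self]
      exact (hu.mul_right_eq_zero).mp this
    rw [hsp] at hmem
    exact hy0 hmem
  · intro i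
    have hab : a i * y * a i = 0 := by
      have := hτ i.succ y
      rw [hy, zero_smul] at this
      simpa [hd] using this
    have hsub : spectrum ℂ (a i * y) ⊆ {0} := by
      apply spectrum_sub_of_sq
      rw [← mul_assoc, hab, zero_mul]
    exact (Set.Nonempty.subset_singleton_iff (spectrum.nonempty (a i * y))).mp hsub
end
end

section
/- Let A be a complex semisimple unital Banach algebra with nonzero socle. If Soc(A) = J_p is the two-sided ideal generated by a single rank one projection p (i.e., A is Shoda-complete), then for every n ∈ ℕ the set R_n = { a ∈ Soc(A) : rank(a) = n } is path-connected. -/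
noncomputable section

/-- The two-sided ideal generated by `p`: finite sums `∑ xᵢ p yᵢ`. -/
def idealGen {A : Type*} [Ring A] (p : A) : Set A :=
  {a | ∃ (n : ℕ) (x y : Fin n → A), a = ∑ i, x i * p * y i}

/-- Invertibility in the corner algebra `pAp`. -/
def CInv {A : Type*} [Ring A] (p x : A) : Prop :=
  ∃ y : A, p * y = y ∧ y * p = y ∧ x * y = p ∧ y * x = p

/-- The spectrum in the corner is nonempty. -/
lemma exists_not_cinv {A : Type*} [NormedRing A] [NormedAlgebra ℂ A] [CompleteSpace A]
    {p : A} (hp : p * p = p) (hp0 : p ≠ 0) {x : A} (hx : p * x = x) (_hx' : x * p = x) :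
    ∃ c : ℂ, ¬ CInv p (x - c • p) := by
  let E : Submodule ℂ A := LinearMap.ker (ContinuousLinearMap.mul ℂ A (1 - p)).toLinearMap
  have hE : ∀ z : A, z ∈ E ↔ p * z = z := by
    intro z
    simp [E, sub_mul, sub_eq_zero, eq_comm]
  have hcl : IsClosed (E : Set A) := (ContinuousLinearMap.mul ℂ A (1 - p)).isClosed_ker
  have : CompleteSpace E := hcl.completeSpace_coe
  have : Nontrivial E := ⟨⟨p, (hE p).2 hp⟩, 0, fun h => hp0 (congrArg Subtype.val h)⟩
  let L : ∀ w : A, p * w = w → (E →L[ℂ] E) := fun w hw =>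
    ((ContinuousLinearMap.mul ℂ A w).comp E.subtypeL).codRestrict E
      (fun z => (hE _).2 (by simp [← mul_assoc, hw]))
  have hL : ∀ w hw (z : E), ((L w hw z : E) : A) = w * z := fun w hw z => rfl
  obtain ⟨c, hc⟩ := spectrum.nonempty (L x hx)
  refine ⟨c, ?_⟩
  rintro ⟨y, hy1, hy2, h1, h2⟩
  apply hc
  have hm : ∀ z : E, p * (z : A) = z := fun z => (hE _).1 z.2
  have e : algebraMap ℂ (E →L[ℂ] E) c - L x hx = - L (x - c • p) (by simp [mul_sub, hx, hp]) := by
    ext z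
    simp [hL, Algebra.algebraMap_eq_smul_one, sub_mul, hm]
  show IsUnit (algebraMap ℂ (E →L[ℂ] E) c - L x hx)
  rw [e]
  refine ⟨⟨_, - L y hy1, ?_, ?_⟩, rfl⟩
  · ext z
    simp only [ContinuousLinearMap.mul_apply, ContinuousLinearMap.neg_apply, map_neg, neg_neg, hL, ← mul_assoc, h1, hm]
    rfl
  · ext z
    simp only [ContinuousLinearMap.mul_apply, ContinuousLinearMap.neg_apply, map_neg, neg_neg, hL, ← mul_assoc, h2, hm]
    rfl

section
variable {A : Type*} [NormedRing A] [NormedAlgebra ℂ A] [CompleteSpace A] {p : A}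

lemma mem_spec_iff (hp : p * p = p) {x : A} (hx : p * x = x) (hx' : x * p = x) {l : ℂ}
    (hl : l ≠ 0) : l ∈ spectrum ℂ x ↔ ¬ CInv p (x - l • p) := by
  rw [spectrum.mem_iff, not_iff_not, Algebra.algebraMap_eq_smul_one]
  constructor
  · rintro ⟨u, hu⟩
    have hcomm : p * (u : A) = u * p := by
      rw [hu]; simp [mul_sub, sub_mul, hx, hx']
    have hcomm' : p * (↑u⁻¹ : A) = ↑u⁻¹ * p := by
      have := (show Commute p (u : A) from hcomm).units_inv_right
      exact this
    have e : x - l • p = - (u * p) := by rw [hu]; simp [sub_mul, hx']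
    refine ⟨- (↑u⁻¹ * p), ?_, ?_, ?_, ?_⟩
    · rw [mul_neg, ← mul_assoc, hcomm', mul_assoc, hp]
    · rw [neg_mul, mul_assoc, hp]
    · rw [e, neg_mul_neg, mul_assoc, ← mul_assoc p, hcomm', mul_assoc _ p p, hp]; simp
    · rw [e, neg_mul_neg, mul_assoc, ← mul_assoc p, hcomm, mul_assoc _ p p, hp]; simp
  · rintro ⟨y, h1, h2, h3, h4⟩
    have h3' : x * y = p + l • y := by
      rw [sub_mul, smul_mul_assoc, h1] at h3; rw [← h3]; abel
    have h4' : y * x = p + l • y := by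
      rw [mul_sub, mul_smul_comm, h2] at h4; rw [← h4]; abel
    refine ⟨⟨l • (1 : A) - x, - y + l⁻¹ • (1 - p), ?_, ?_⟩, rfl⟩
    · simp [mul_add, sub_mul, mul_sub, h3', hx', smul_smul, hl, smul_sub]
    · simp [mul_add, add_mul, sub_mul, mul_sub, h4', hx, smul_smul, hl, smul_sub]

/-- `pAp = ℂp`. -/
lemma corner_scalar (hss : ∀ a : A, (∀ x : A, spectrum ℂ (a * x) ⊆ {0}) → a = 0)
    (hp : p * p = p) (hp1 : rankLE p 1) (hp0 : p ≠ 0) (a : A) : ∃ c : ℂ, p * a * p = c • p := by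
  have hx : p * (p * a * p) = p * a * p := by simp [← mul_assoc, hp]
  have hx' : (p * a * p) * p = p * a * p := by simp [mul_assoc, hp]
  obtain ⟨c, hc⟩ := exists_not_cinv hp hp0 hx hx'
  refine ⟨c, sub_eq_zero.1 (hss _ ?_)⟩
  set q := p * a * p - c • p with hq
  have q1 : p * q = q := by simp [hq, mul_sub, hx, hp]
  have q2 : q * p = q := by simp [hq, sub_mul, hx', hp]
  -- an element of the corner with a nonzero spectral value is invertible in the corner
  have key : ∀ z : A, p * z = z → z * p = z → ∀ m : ℂ, m ≠ 0 → m ∈ spectrum ℂ z → CInv p z := by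
    intro z hz hz' m hm hmz
    by_contra hcon
    have e1 : m ∈ spectrum ℂ (z + m • p) := by
      rw [mem_spec_iff hp (by simp [mul_add, hz, hp]) (by simp [add_mul, hz', hp]) hm]
      simpa using hcon
    have e2 : 2 * m ∈ spectrum ℂ (z + m • p) := by
      rw [mem_spec_iff hp (by simp [mul_add, hz, hp]) (by simp [add_mul, hz', hp])
        (mul_ne_zero two_ne_zero hm)]
      rw [mem_spec_iff hp hz hz' hm] at hmz
      convert hmz using 2
      rw [two_mul, add_smul]; abel
    have hzp : (z + m • p) * p = z + m • p := by simp [add_mul, hz', hp]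
    obtain ⟨hf, hn⟩ := hp1 (z + m • p)
    rw [hzp] at hf hn
    have := (Set.ncard_le_one hf).1 hn m ⟨e1, hm⟩ (2 * m) ⟨e2, mul_ne_zero two_ne_zero hm⟩
    apply hm
    linear_combination -this
  intro y m hm
  by_contra hm0
  replace hm0 : m ≠ 0 := hm0
  have t1 : m ∈ spectrum ℂ (q * (p * y * p)) := by
    have : m ∈ spectrum ℂ (p * (q * y)) \ {0} := ⟨by rwa [← mul_assoc, q1], hm0⟩
    rw [spectrum.nonzero_mul_comm] at this
    have h2 := this.1
    rwa [show q * y * p = q * (p * y * p) by simp [← mul_assoc, q2]] at h2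
  have t2 : m ∈ spectrum ℂ ((p * y * p) * q) := by
    have : m ∈ spectrum ℂ (q * (p * y * p)) \ {0} := ⟨t1, hm0⟩
    rw [spectrum.nonzero_mul_comm] at this
    exact this.1
  obtain ⟨r, r1, r2, r3, r4⟩ := key _ (by rw [← mul_assoc, q1])
    (by simp [mul_assoc, hp]) m hm0 t1
  obtain ⟨s, s1, s2, s3, s4⟩ := key _ (by simp [← mul_assoc, hp])
    (by rw [mul_assoc, q2]) m hm0 t2
  -- right inverse of q : (p y p) r ; left inverse : s (p y p)
  apply hc
  have hR : q * (p * y * p * r) = p := by rw [← mul_assoc, r3]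
  have hL : (s * (p * y * p)) * q = p := by rw [mul_assoc, s4]
  have heq : s * (p * y * p) = p * y * p * r := by
    calc s * (p * y * p) = s * (p * y * p) * p := by simp [mul_assoc, hp]
      _ = s * (p * y * p) * q * (p * y * p * r) := by rw [mul_assoc _ q, hR]
      _ = p * y * p * r := by rw [hL]; simp [← mul_assoc, hp]
  exact ⟨p * y * p * r, by simp [← mul_assoc, hp], by rw [mul_assoc, r2], hR, by rw [← heq, hL]⟩

end

/-- Linear algebra: dual families. -/
lemma exists_dual {V W : Type*} [AddCommGroup V] [Module ℂ V] [AddCommGroup W] [Module ℂ W]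
    (B : V →ₗ[ℂ] W →ₗ[ℂ] ℂ) {n : ℕ} (x : Fin n → W) (hx : LinearIndependent ℂ x)
    (hsep : ∀ c : Fin n → ℂ, (∀ v, B v (∑ j, c j • x j) = 0) → ∑ j, c j • x j = 0) :
    ∃ v : Fin n → V, ∀ i j, B (v i) (x j) = if i = j then 1 else 0 := by
  let T : V →ₗ[ℂ] (Fin n → ℂ) := LinearMap.pi fun j => B.flip (x j)
  have hT : LinearMap.range T = ⊤ := by
    by_contra hne
    obtain ⟨f, hf0, hf⟩ := Submodule.exists_le_ker_of_lt_top _ (lt_top_iff_ne_top.2 hne)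
    apply hf0
    have hfe : ∀ g : Fin n → ℂ, f g = ∑ j, g j * f (Pi.single j 1) := by
      intro g
      conv_lhs => rw [pi_eq_sum_univ' g]
      simp
    have h0 := hsep (fun j => f (Pi.single j 1)) (by
      intro v
      have : f (T v) = 0 := hf ⟨v, rfl⟩
      rw [hfe] at this
      rw [← this]
      simp [T, mul_comm])
    have := Fintype.linearIndependent_iff.1 hx _ h0
    ext j
    simpa using this j
  have hs := LinearMap.range_eq_top.1 hT
  choose v hv using fun i : Fin n => hs (Pi.single i 1)
  refine ⟨v, fun i j => ?_⟩
  have := congrFun (hv i) j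
  simp only [Pi.single_apply, T, LinearMap.pi_apply, LinearMap.flip_apply] at this
  rw [this]
  simp [eq_comm]

lemma finite_bad {W : Type*} [AddCommGroup W] [Module ℂ W] {n : ℕ} (x x' : Fin n → W)
    (hx : LinearIndependent ℂ x) :
    {t : ℂ | ¬ LinearIndependent ℂ (fun i => (1 - t) • x i + t • x' i)}.Finite := by
  obtain ⟨g, hg⟩ := LinearMap.exists_leftInverse_of_injective (Fintype.linearCombination ℂ x)
    (LinearMap.ker_eq_bot.2 (linearIndependent_iff_injective_fintypeLinearCombination.1 hx))
  have hgx : ∀ i, g (x i) = Pi.single i 1 := by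
    intro i
    have := LinearMap.congr_fun hg (Pi.single i 1)
    simpa using this
  let P : Matrix (Fin n) (Fin n) (Polynomial ℂ) := fun i j =>
    Polynomial.C ((Pi.single i 1 : Fin n → ℂ) j) * (1 - Polynomial.X) +
      Polynomial.C (g (x' i) j) * Polynomial.X
  have hP : ∀ t, P.det.eval t = (Matrix.of fun i => g ((1 - t) • x i + t • x' i)).det := by
    intro t
    rw [← Polynomial.coe_evalRingHom, RingHom.map_det]
    congr 1
    ext i j
    simp only [RingHom.mapMatrix_apply, Matrix.map_apply, Matrix.of_apply]
    simp [P, hgx]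
    ring
  have hP0 : P.det ≠ 0 := by
    intro h
    have := hP 0
    rw [h] at this
    have e : (Matrix.of fun i => g ((1 - (0:ℂ)) • x i + (0:ℂ) • x' i)) =
        (1 : Matrix (Fin n) (Fin n) ℂ) := by
      ext i j
      simp [hgx, Matrix.one_apply, Pi.single_apply, eq_comm]
    rw [e] at this
    simp at this
  refine (P.det.rootSet_finite ℂ).subset ?_
  intro t ht
  rw [Polynomial.mem_rootSet]
  refine ⟨hP0, ?_⟩
  by_contra hne
  apply ht
  rw [Polynomial.coe_aeval_eq_eval, hP] at hne
  have := Matrix.linearIndependent_rows_of_det_ne_zero hne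
  exact LinearIndependent.of_comp g this

section
variable {A : Type*} [NormedRing A] [NormedAlgebra ℂ A]

/-- `∑ wᵢ yᵢ` has at most `n` nonzero spectral values. -/
lemma spec_bound {p : A} {n : ℕ} (w y : Fin n → A) (M : Matrix (Fin n) (Fin n) ℂ)
    (hw : ∀ i, w i * p = w i) (hM : ∀ i j, y i * w j = M i j • p) :
    (spectrum ℂ (∑ i, w i * y i) \ {0}).Finite ∧
      (spectrum ℂ (∑ i, w i * y i) \ {0}).ncard ≤ n := by
  set b := ∑ i, w i * y i with hb
  let φ : Matrix (Fin n) (Fin n) ℂ → A := fun N => ∑ j, (∑ i, N i j • w i) * y j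
  have hφadd : ∀ N N', φ (N + N') = φ N + φ N' := by
    intro N N'; simp [φ, add_smul, add_mul, Finset.sum_add_distrib]
  have hφsmul : ∀ (c : ℂ) N, φ (c • N) = c • φ N := by
    intro c N; simp [φ, mul_smul, Finset.smul_sum, smul_mul_assoc, Finset.sum_mul]
  have hφ1 : φ 1 = b := by
    simp [φ, hb, Matrix.one_apply]
  have hbw : ∀ j, b * w j = ∑ i, M i j • w i := by
    intro j
    simp [hb, Finset.sum_mul, mul_assoc, hM, hw]
  have hφM : ∀ N, b * φ N = φ (M * N) := by
    intro N
    simp only [φ, Finset.mul_sum]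
    refine Finset.sum_congr rfl fun j _ => ?_
    rw [← mul_assoc]
    congr 1
    simp only [Finset.mul_sum, mul_smul_comm, hbw, Finset.smul_sum, Matrix.mul_apply,
      Finset.sum_smul, smul_smul]
    rw [Finset.sum_comm]
    simp [mul_comm]
  have hφp : ∀ f : Polynomial ℂ, ∀ N, Polynomial.aeval b f * φ N = φ (Polynomial.aeval M f * N) := by
    intro f
    induction f using Polynomial.induction_on' with
    | add f g hf hg => intro N; simp [add_mul, hf, hg, hφadd]
    | monomial k c =>
      intro N
      simp only [Polynomial.aeval_monomial, Algebra.algebraMap_eq_smul_one, smul_mul_assoc, one_mul,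
        hφsmul]
      congr 1
      induction k with
      | zero => simp
      | succ k ih => rw [pow_succ', mul_assoc, ih, hφM, pow_succ', mul_assoc]
  have hzero : Polynomial.aeval b (M.charpoly * Polynomial.X) = 0 := by
    rw [map_mul, Polynomial.aeval_X]
    have := hφp M.charpoly 1
    rw [hφ1, Matrix.aeval_self_charpoly] at this
    rw [this]
    simp [φ]
  have hsub : spectrum ℂ b \ {0} ⊆ (M.charpoly.roots.toFinset : Set ℂ) := by
    rintro l ⟨hl, hl0⟩
    have h1 := spectrum.subset_polynomial_aeval b (M.charpoly * Polynomial.X) ⟨l, hl, rfl⟩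
    rw [hzero] at h1
    have hnt : Nontrivial A := by
      by_contra hn
      rw [not_nontrivial_iff_subsingleton] at hn
      rw [spectrum.of_subsingleton] at hl
      exact hl
    rw [spectrum.zero_eq] at h1
    have h2 : l ≠ 0 := hl0
    simp [h2] at h1
    simp [M.charpoly_monic.ne_zero, h1]
  refine ⟨(Finset.finite_toSet _).subset hsub, ?_⟩
  calc _ ≤ (M.charpoly.roots.toFinset : Set ℂ).ncard :=
        Set.ncard_le_ncard hsub (Finset.finite_toSet _)
    _ = M.charpoly.roots.toFinset.card := Set.ncard_coe_finset _
    _ ≤ M.charpoly.roots.card := Multiset.toFinset_card_le _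
    _ ≤ M.charpoly.natDegree := Polynomial.card_roots' _
    _ = n := by simp

lemma hasRank_unique {a : A} {m n : ℕ} (hm : hasRank a m) (hn : hasRank a n) : m = n := by
  obtain ⟨h1, x, hx⟩ := hm
  obtain ⟨h2, y, hy⟩ := hn
  have := (h1 y).2
  have := (h2 x).2
  omega

/-- Representations with linearly independent factors. -/
def IndepRep (p a : A) (n : ℕ) : Prop :=
  ∃ x y : Fin n → A, (∀ i, x i * p = x i) ∧ (∀ i, p * y i = y i) ∧ LinearIndependent ℂ x ∧
    LinearIndependent ℂ y ∧ a = ∑ i, x i * y i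

lemma eq_zero_of_sq (hss : ∀ a : A, (∀ x : A, spectrum ℂ (a * x) ⊆ {0}) → a = 0) {w : A}
    (h : ∀ v, w * v * w = 0) : w = 0 := by
  refine hss _ fun v l hl => ?_
  have h1 := spectrum.subset_polynomial_aeval (w * v) (Polynomial.X ^ 2) ⟨l, hl, rfl⟩
  have e : (w * v) ^ 2 = 0 := by rw [sq, ← mul_assoc, h, zero_mul]
  have hnt : Nontrivial A := by
    by_contra hn
    rw [not_nontrivial_iff_subsingleton] at hn
    rw [spectrum.of_subsingleton] at hl
    exact hl
  simpa [e, spectrum.zero_eq] using h1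

set_option maxHeartbeats 800000 in
lemma hasRank_of_rep (hss : ∀ a : A, (∀ x : A, spectrum ℂ (a * x) ⊆ {0}) → a = 0)
    {p : A} (hp : p * p = p) (hp0 : p ≠ 0) (hsc : ∀ a : A, ∃ c : ℂ, p * a * p = c • p)
    {a : A} {n : ℕ} (h : IndepRep p a n) : hasRank a n := by
  obtain ⟨x, y, hx, hy, lx, ly, rfl⟩ := h
  choose τ hτ using hsc
  have inj : ∀ c d : ℂ, c • p = d • p → c = d := fun c d h => smul_left_injective ℂ hp0 h
  let T : A →ₗ[ℂ] ℂ :=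
    { toFun := τ
      map_add' := fun a b => inj _ _ (by rw [← hτ, add_smul, ← hτ, ← hτ, mul_add, add_mul])
      map_smul' := fun c a => inj _ _ (by
        rw [← hτ, RingHom.id_apply, smul_eq_mul, mul_smul, ← hτ, mul_smul_comm, smul_mul_assoc]) }
  have hT : ∀ a, p * a * p = T a • p := hτ
  have hle : rankLE (∑ i, x i * y i) n := by
    intro z
    have := spec_bound (p := p) (fun i => z * x i) y (fun i j => T (y i * (z * x j)))
      (fun i => by rw [mul_assoc, hx]) (fun i j => by
        rw [← hT, ← mul_assoc p, hy, mul_assoc, mul_assoc z, hx])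
    simpa only [Finset.mul_sum, mul_assoc] using this
  obtain ⟨v, hv⟩ := exists_dual ((LinearMap.mul ℂ A).compr₂ T) x lx (by
    intro c hc
    set w := ∑ j, c j • x j with hw
    have hwp : w * p = w := by simp [hw, Finset.sum_mul, hx]
    refine eq_zero_of_sq hss fun v => ?_
    have h1 : T (v * w) = 0 := by simpa using hc v
    have h2 := hT (v * w)
    rw [h1, zero_smul] at h2
    calc w * v * w = w * (p * (v * w) * p) := by
          rw [mul_assoc p, mul_assoc v, hwp, ← mul_assoc w p, hwp, mul_assoc]
      _ = 0 := by rw [h2, mul_zero])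
  obtain ⟨u, hu⟩ := exists_dual ((LinearMap.mul ℂ A).flip.compr₂ T) y ly (by
    intro c hc
    set w := ∑ j, c j • y j with hw
    have hwp : p * w = w := by simp [hw, Finset.mul_sum, hy]
    refine eq_zero_of_sq hss fun v => ?_
    have h1 : T (w * v) = 0 := by simpa using hc v
    have h2 := hT (w * v)
    rw [h1, zero_smul] at h2
    calc w * v * w = (p * (w * v) * p) * w := by
          rw [mul_assoc _ p w, hwp, ← mul_assoc p, hwp]
      _ = 0 := by rw [h2, zero_mul])
  have hv' : ∀ i j, p * v i * x j = if i = j then p else 0 := by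
    intro i j
    have h1 := hT (v i * x j)
    have h2 : T (v i * x j) = if i = j then 1 else 0 := by simpa using hv i j
    rw [h2, mul_assoc p, mul_assoc (v i), hx, ← mul_assoc] at h1
    rw [h1]; split_ifs <;> simp
  have hu' : ∀ i j, y i * (u j * p) = if i = j then p else 0 := by
    intro i j
    have h1 := hT (y i * u j)
    have h2 : T (y i * u j) = if j = i then 1 else 0 := by simpa using hu j i
    rw [h2, ← mul_assoc p, hy, mul_assoc] at h1
    rw [h1]
    by_cases h3 : i = j
    · rw [if_pos h3, if_pos h3.symm, one_smul]
    · rw [if_neg h3, if_neg (Ne.symm h3), zero_smul]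
  refine ⟨hle, ∑ k : Fin n, ((k : ℕ) + 1 : ℂ) • (u k * p * (p * v k)), ?_⟩
  set z := ∑ k : Fin n, ((k : ℕ) + 1 : ℂ) • (u k * p * (p * v k)) with hz
  have hza : z * (∑ i, x i * y i) = ∑ k : Fin n, ((k : ℕ) + 1 : ℂ) • (u k * p * y k) := by
    rw [hz, Finset.sum_mul]
    refine Finset.sum_congr rfl fun k _ => ?_
    rw [smul_mul_assoc, Finset.mul_sum]
    have : ∀ i, u k * p * (p * v k) * (x i * y i) = if k = i then u k * p * y k else 0 := by
      intro i
      rw [mul_assoc (u k * p), ← mul_assoc (p * v k), hv']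
      split_ifs with h
      · subst h; rw [hy]
      · simp
    simp only [this]
    simp
  obtain ⟨hfin, hcard⟩ := hle z
  refine le_antisymm hcard ?_
  have hmem : Set.range (fun k : Fin n => ((k : ℕ) + 1 : ℂ)) ⊆
      spectrum ℂ (z * (∑ i, x i * y i)) \ {0} := by
    rintro _ ⟨k, rfl⟩
    refine ⟨?_, Nat.cast_add_one_ne_zero _⟩
    rw [hza]
    intro hunit
    have hk : (∑ k : Fin n, ((k : ℕ) + 1 : ℂ) • (u k * p * y k)) * (u k * p) =
        ((k : ℕ) + 1 : ℂ) • (u k * p) := by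
      simp only [Finset.sum_mul, smul_mul_assoc, mul_assoc _ (y _), hu']
      simp [mul_assoc, hp]
    have h0 : (algebraMap ℂ A ((k : ℕ) + 1 : ℂ) -
        ∑ k : Fin n, ((k : ℕ) + 1 : ℂ) • (u k * p * y k)) * (u k * p) = 0 := by
      rw [sub_mul, hk, Algebra.algebraMap_eq_smul_one, smul_mul_assoc, one_mul, sub_self]
    have h1 : u k * p = 0 := (IsUnit.mul_right_eq_zero hunit).1 h0
    have h2 := hu' k k
    rw [h1] at h2
    simp at h2
    exact hp0 h2.symm
  calc n = (Set.range (fun k : Fin n => ((k : ℕ) + 1 : ℂ))).ncard := by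
        rw [← Set.image_univ, Set.ncard_image_of_injective]
        · simp [Set.ncard_univ]
        · intro i j hij
          simpa [Fin.ext_iff] using hij
    _ ≤ _ := Set.ncard_le_ncard hmem hfin

lemma solve_dep {m : ℕ} (y : Fin (m + 1) → A) (c : Fin (m + 1) → ℂ) (hc : ∑ i, c i • y i = 0)
    (k : Fin (m + 1)) (hk : c k ≠ 0) :
    y k = ∑ i, (-(c k)⁻¹ * c (k.succAbove i)) • y (k.succAbove i) := by
  rw [Fin.sum_univ_succAbove _ k] at hc
  simp only [mul_smul, ← Finset.smul_sum]
  rw [← neg_eq_of_add_eq_zero_right hc, smul_neg, neg_smul, neg_neg, smul_smul,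
    inv_mul_cancel₀ hk, one_smul]

lemma exists_rep {p : A} (m : ℕ) : ∀ (x y : Fin m → A), (∀ i, x i * p = x i) →
    (∀ i, p * y i = y i) → ∃ n, IndepRep p (∑ i, x i * y i) n := by
  induction m with
  | zero =>
    intro x y hx hy
    exact ⟨0, x, y, hx, hy, linearIndependent_empty_type, linearIndependent_empty_type, rfl⟩
  | succ m ih =>
    intro x y hx hy
    by_cases lx : LinearIndependent ℂ x
    · by_cases ly : LinearIndependent ℂ y
      · exact ⟨m + 1, x, y, hx, hy, lx, ly, rfl⟩
      · obtain ⟨c, hc, k, hk⟩ := Fintype.not_linearIndependent_iff.1 ly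
        have hyk : y k = ∑ i, (-(c k)⁻¹ * c (k.succAbove i)) • y (k.succAbove i) := solve_dep y c hc k hk
        have := ih (fun i => x (k.succAbove i) + (-(c k)⁻¹ * c (k.succAbove i)) • x k)
          (fun i => y (k.succAbove i)) (fun i => by simp [add_mul, hx]) (fun i => hy _)
        convert this using 3
        rw [Fin.sum_univ_succAbove _ k, hyk]
        simp [add_mul, Finset.sum_add_distrib, Finset.mul_sum, add_comm]
    · obtain ⟨c, hc, k, hk⟩ := Fintype.not_linearIndependent_iff.1 lx
      have hxk : x k = ∑ i, (-(c k)⁻¹ * c (k.succAbove i)) • x (k.succAbove i) := solve_dep x c hc k hk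
      have := ih (fun i => x (k.succAbove i))
        (fun i => y (k.succAbove i) + (-(c k)⁻¹ * c (k.succAbove i)) • y k)
        (fun i => hx _) (fun i => by simp [mul_add, hy])
      convert this using 3
      rw [Fin.sum_univ_succAbove _ k, hxk]
      simp [mul_add, Finset.sum_add_distrib, Finset.sum_mul, add_comm]

end

/-- If `A` is Shoda-complete, i.e. `Soc(A) = J_p` for a rank one projection `p`, then for
each `n` any two elements of rank `n` can be joined by a path of rank `n` elements. -/
theorem rank_n_set_path_connected {A : Type*} [NormedRing A] [NormedAlgebra ℂ A]
    [CompleteSpace A]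
    (hss : ∀ a : A, (∀ x : A, spectrum ℂ (a * x) ⊆ {0}) → a = 0)
    (p : A) (hp : IsIdempotentElem p) (hp1 : hasRank p 1)
    (hshoda : {a : A | ∃ n : ℕ, rankLE a n} = idealGen p) :
    ∀ n : ℕ, ∀ a ∈ {a : A | hasRank a n}, ∀ b ∈ {a : A | hasRank a n},
      JoinedIn {a : A | hasRank a n} a b := by
  have hpp : p * p = p := hp
  have hp0 : p ≠ 0 := by
    rintro rfl
    obtain ⟨_, x, hx⟩ := hp1
    have hs : spectrum ℂ (x * (0 : A)) \ {0} = ∅ := by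
      rcases subsingleton_or_nontrivial A with hA | hA
      · simp [spectrum.of_subsingleton]
      · simp [spectrum.zero_eq]
    rw [hs] at hx
    simp at hx
  have hsc := corner_scalar hss hpp hp1.1 hp0
  have hrep : ∀ a n, hasRank a n → IndepRep p a n := by
    intro a n ha
    have : a ∈ idealGen p := hshoda ▸ (show a ∈ {a : A | ∃ n : ℕ, rankLE a n} from ⟨n, ha.1⟩)
    obtain ⟨m, x, y, rfl⟩ := this
    obtain ⟨k, hk⟩ := exists_rep (p := p) m (fun i => x i * p) (fun i => p * y i)
      (fun i => by rw [mul_assoc, hpp]) (fun i => by rw [← mul_assoc, hpp])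
    have e : ∑ i, x i * p * (p * y i) = ∑ i, x i * p * y i :=
      Finset.sum_congr rfl fun i _ => by rw [← mul_assoc, mul_assoc (x i), hpp]
    rw [e] at hk
    rwa [hasRank_unique ha (hasRank_of_rep hss hpp hp0 hsc hk)]
  intro n a ha b hb
  obtain ⟨x, y, hx, hy, lx, ly, rfl⟩ := hrep a n ha
  obtain ⟨x', y', hx', hy', lx', ly', rfl⟩ := hrep b n hb
  have hfin := (finite_bad x x' lx).union (finite_bad y y' ly)
  have hpc := hfin.countable.isPathConnected_compl_of_one_lt_rank
    (by rw [Complex.rank_real_complex]; exact Nat.one_lt_ofNat)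
  have hj := hpc.joinedIn 0 (by simp [lx, ly]) 1 (by simp [lx', ly'])
  have hj2 := hj.map (f := fun t : ℂ => ∑ i, ((1 - t) • x i + t • x' i) * ((1 - t) • y i + t • y' i))
    (by fun_prop)
  simp only [sub_zero, one_smul, zero_smul, add_zero, sub_self, zero_add] at hj2
  refine hj2.mono ?_
  rintro _ ⟨t, ht, rfl⟩
  simp only [Set.mem_compl_iff, Set.mem_union, Set.mem_ofPred_eq, not_or, not_not] at ht
  exact hasRank_of_rep hss hpp hp0 hsc ⟨_, _, fun i => by simp [add_mul, hx, hx'],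
    fun i => by simp [mul_add, hy, hy'], ht.1, ht.2, rfl⟩
end
end
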